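/- arXiv:1503.02133 — 4 statements merged into one kernel-verified Lean document; each statement's English description precedes it below -/
import Mathlib

section
/- Let A be a Noetherian commutative ring, M a finitely generated A-module, and I an ideal of A. Then depth_A(I, M) equals the infimum of the set of integers n such that the local cohomology module H^n_I(M) is nonzero. -/
open CategoryTheory

/-- The depth of a module over a local ring, defined (following the paper) as the
infimum of the set of `n` with nonvanishing local cohomology at the maximal ideal. -/
noncomputable def localDepth (A : Type) [CommRing A] [IsLocalRing A]
    (M : Type) [AddCommGroup M] [Module A M] : ℕ∞ :=
  sInf {n : ℕ∞ | ∃ m : ℕ, n = (m : ℕ∞) ∧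
    Nontrivial ((localCohomology (IsLocalRing.maximalIdeal A) m).obj (ModuleCat.of A M))}

/-- `depth_{A_P} M_P` for a prime `P`. -/
noncomputable def primeLocalDepth (A : Type) [CommRing A] (P : Ideal A)
    (hP : P.IsPrime) (M : Type) [AddCommGroup M] [Module A M] : ℕ∞ :=
  haveI := hP
  localDepth (Localization.AtPrime P) (LocalizedModule P.primeCompl M)

/-- `depth_A(I, M) = inf_{P ∈ V(I)} depth_{A_P} M_P`. -/
noncomputable def idealDepth (A : Type) [CommRing A] (I : Ideal A)
    (M : Type) [AddCommGroup M] [Module A M] : ℕ∞ :=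
  sInf {d : ℕ∞ | ∃ (P : Ideal A) (hP : P.IsPrime),
    I ≤ P ∧ d = primeLocalDepth A P hP M}

section comparison
universe v u
open Abelian HomologicalComplex

lemma CategoryTheory.ProjectiveResolution.extMk_eq_zero_iff_exists
    {C : Type u} [Category.{v} C] [Abelian C] [HasExt.{v} C] {X Y : C}
    (P : ProjectiveResolution X) {n : ℕ} (f : P.complex.X n ⟶ Y)
    (hf : P.complex.d (n + 1) n ≫ f = 0) :
    P.extMk f (n + 1) rfl hf = 0 ↔ ∃ (p : ℕ) (g : P.complex.X p ⟶ Y), P.complex.d n p ≫ g = f := by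
  cases n with
  | zero =>
    refine ⟨fun h ↦ ⟨0, 0, ?_⟩, fun ⟨p, g, h⟩ ↦ ?_⟩
    · rw [Limits.comp_zero]
      rw [← P.extEquivCohomologyClass.apply_eq_iff_eq, P.extEquivCohomologyClass_extMk,
        P.extEquivCohomologyClass_zero, CochainComplex.HomComplex.CohomologyClass.mk_eq_zero_iff,
        CochainComplex.HomComplex.Cocycle.toSingleMk_mem_coboundaries_iff _ _ _ _ _ 1 (by lia)] at h
      obtain ⟨g, hg⟩ := h
      rw [← cancel_epi (P.cochainComplexXIso (-(0 : ℕ)) 0 rfl).hom, ← hg]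
      have : P.cochainComplex.d (-(0 : ℕ)) 1 = 0 := by
        apply Limits.IsZero.eq_of_tgt
        exact CochainComplex.isZero_of_isStrictlyLE _ 0 _ (by lia)
      rw [this, Limits.zero_comp, Limits.comp_zero]
    · simp [← h]
  | succ n =>
    rw [P.extMk_eq_zero_iff f _ rfl hf n rfl]
    refine ⟨fun ⟨g, hg⟩ ↦ ⟨n, g, hg⟩, fun ⟨p, g, h⟩ ↦ ?_⟩
    by_cases hp : p = n
    · subst hp; exact ⟨g, h⟩
    · have : P.complex.d (n + 1) p = 0 := P.complex.shape _ _ (by simpa using hp)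
      exact ⟨0, by simp [← h, this]⟩

lemma HomologicalComplex.injective_homologyMap {R : Type u} [Ring R] {ι : Type*}
    {c : ComplexShape ι}
    {K L : HomologicalComplex (ModuleCat.{v} R) c} (φ : K ⟶ L) (n : ι)
    (h : ∀ x : K.X n, (∀ m, K.d n m x = 0) → (∃ p, ∃ y : L.X p, L.d p n y = φ.f n x) →
      ∃ p, ∃ y : K.X p, K.d p n y = x) :
    Function.Injective (homologyMap φ n) := by
  rw [injective_iff_map_eq_zero]
  intro x hx
  obtain ⟨z, rfl⟩ := (ModuleCat.epi_iff_surjective (K.homologyπ n)).1 inferInstance x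
  have hz : L.homologyπ n (cyclesMap φ n z) = 0 := by
    rw [← hx, ← ModuleCat.comp_apply, ← ModuleCat.comp_apply, homologyπ_naturality]
  have exL := (ShortComplex.moduleCat_exact_iff _).1 (ShortComplex.exact_of_g_is_cokernel
    (.mk _ _ (L.toCycles_comp_homologyπ (c.prev n) n)) (L.homologyIsCokernel (c.prev n) n rfl))
  have exK := (ShortComplex.moduleCat_exact_iff _).1 (ShortComplex.exact_of_g_is_cokernel
    (.mk _ _ (K.toCycles_comp_homologyπ (c.prev n) n)) (K.homologyIsCokernel (c.prev n) n rfl))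
  obtain ⟨y, hy⟩ := exL _ hz
  replace hy : L.toCycles (c.prev n) n y = cyclesMap φ n z := hy
  have hd : ∀ m, K.d n m (K.iCycles n z) = 0 := fun m ↦ by
    rw [← ModuleCat.comp_apply, iCycles_d]; rfl
  have hyd : L.d (c.prev n) n y = φ.f n (K.iCycles n z) := by
    rw [← L.toCycles_i, ModuleCat.comp_apply, hy, ← ModuleCat.comp_apply, ← ModuleCat.comp_apply,
      cyclesMap_i]
  obtain ⟨p, w, hw⟩ := h _ hd ⟨_, y, hyd⟩
  have : z = K.toCycles p n w := by
    apply (ModuleCat.mono_iff_injective (K.iCycles n)).1 inferInstance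
    rw [← hw, ← ModuleCat.comp_apply, toCycles_i]
  rw [this, ← ModuleCat.comp_apply, toCycles_comp_homologyπ]
  rfl

lemma HomologicalComplex.epi_homologyMap_opFunctor_map {C : Type u} [Category.{v} C] [Abelian C]
    {ι : Type*} {c : ComplexShape ι} {K L : HomologicalComplex C c} (φ : K ⟶ L) (n : ι)
    [Mono (homologyMap φ n)] : Epi (homologyMap ((opFunctor _ _).map φ.op) n) := by
  have : homologyMap ((opFunctor _ _).map φ.op) n =
      (L.homologyOp n).hom ≫ (homologyMap φ n).op ≫ (K.homologyOp n).inv := by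
    have h := homologyOp_hom_naturality φ n
    exact (Iso.eq_comp_inv (K.homologyOp n)).2 h |>.trans (Category.assoc ..)
  rw [this]
  have : Epi (homologyMap φ n).op := op_epi_of_mono _
  have h₁ : Epi (L.homologyOp n).hom := inferInstance
  have h₂ : Epi (K.homologyOp n).inv := inferInstance
  exact epi_comp' h₁ (epi_comp' this h₂)

section

variable {A : Type} [CommRing A] {X X' Y : ModuleCat.{0} A}

lemma CategoryTheory.subsingleton_ext_iff (n : ℕ) (P : ProjectiveResolution X) :
    Subsingleton (Abelian.Ext X Y n) ↔ ∀ f : P.complex.X n ⟶ Y, P.complex.d (n + 1) n ≫ f = 0 →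
      ∃ (p : ℕ) (g : P.complex.X p ⟶ Y), P.complex.d n p ≫ g = f := by
  refine ⟨fun h f hf ↦ (P.extMk_eq_zero_iff_exists f hf).1 (Subsingleton.elim _ _), fun h ↦ ?_⟩
  refine subsingleton_of_forall_eq 0 fun a ↦ ?_
  obtain ⟨f, hf, rfl⟩ := P.extMk_surjective a _ rfl
  exact (P.extMk_eq_zero_iff_exists f hf).2 (h f hf)

lemma injective_ext_map (n : ℕ) (g : X' ⟶ X)
    (h : Function.Injective fun a : Abelian.Ext X Y n ↦ (Ext.mk₀ g).comp a (zero_add n)) :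
    Function.Injective (((_root_.Ext A (ModuleCat.{0} A) n).map g.op).app Y) := by
  let P := projectiveResolution X
  let P' := projectiveResolution X'
  let φ := ProjectiveResolution.lift g P' P
  let Φ : ProjectiveResolution.Hom P' P g :=
    ⟨φ, by simpa [φ] using ProjectiveResolution.lift_commutes_zero g P' P⟩
  rw [← ModuleCat.mono_iff_injective]
  change Mono ((((linearYoneda A (ModuleCat.{0} A)).obj Y).rightOp.leftDerived n).map g).unop
  rw [Functor.leftDerived_map_eq _ n g φ (by simp [φ])]
  let ψ : P.complex.linearYonedaObj A Y ⟶ P'.complex.linearYonedaObj A Y :=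
    (unopFunctor _ _).map
      ((((linearYoneda A (ModuleCat.{0} A)).obj Y).rightOp.mapHomologicalComplex _).map φ).op
  have hψ : Mono (homologyMap ψ n) := by
    rw [ModuleCat.mono_iff_injective]
    apply injective_homologyMap
    intro x hx ⟨p, y, hy⟩
    have hd : P.complex.d (n + 1) n ≫ x = 0 := hx (n + 1)
    have hn : (Ext.mk₀ g).comp (P.extMk x (n + 1) rfl hd) (zero_add n) = 0 := by
      rw [ProjectiveResolution.mk₀_comp_extMk x (n + 1) rfl hd Φ,
        P'.extMk_eq_zero_iff_exists]
      exact ⟨p, y, hy⟩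
    exact (P.extMk_eq_zero_iff_exists x hd).1 (h (hn.trans (Ext.comp_zero ..).symm))
  have : Epi ((((linearYoneda A (ModuleCat.{0} A)).obj Y).rightOp.mapHomologicalComplex _ ⋙
      homologyFunctor (ModuleCat A)ᵒᵖ (ComplexShape.down ℕ) n).map φ) :=
    epi_homologyMap_opFunctor_map ψ n
  infer_instance

lemma subsingleton_ext_obj_iff (n : ℕ) :
    Subsingleton (((_root_.Ext A (ModuleCat.{0} A) n).obj (.op X)).obj Y) ↔
      Subsingleton (Abelian.Ext X Y n) := by
  let P := projectiveResolution X
  rw [CategoryTheory.subsingleton_ext_iff n P, ← ModuleCat.isZero_iff_subsingleton,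
    (P.isoExt n Y).isZero_iff, ← exactAt_iff_isZero_homology,
    exactAt_iff' _ _ n (n + 1) rfl (by simp), ShortComplex.moduleCat_exact_iff]
  refine forall₂_congr fun f hf ↦ ⟨fun ⟨g, hg⟩ ↦ ⟨_, g, hg⟩, fun ⟨p, g, hg⟩ ↦ ?_⟩
  by_cases hp : p + 1 = n
  · obtain rfl : (ComplexShape.up ℕ).prev n = p := ComplexShape.prev_eq' _ hp
    exact ⟨g, hg⟩
  · refine ⟨0, ?_⟩
    rw [P.complex.shape _ _ hp, Limits.zero_comp] at hg
    rw [map_zero]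
    exact hg

end

end comparison

section
open Limits Abelian
variable {A : Type} [CommRing A] (I : Ideal A) (M : ModuleCat.{0} A) (n : ℕ)

lemma subsingleton_localCohomology_obj
    (h : ∀ t, Subsingleton (Abelian.Ext (ModuleCat.of A (A ⧸ I ^ t)) M n)) :
    Subsingleton ((localCohomology I n).obj M) := by
  let F := localCohomology.diagram (localCohomology.idealPowersDiagram I) n
  let hc := isColimitOfPreserves ((evaluation _ _).obj M) (colimit.isColimit F)
  refine subsingleton_of_forall_eq 0 fun x ↦ ?_
  obtain ⟨j, y, rfl⟩ := Concrete.isColimit_exists_rep _ hc x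
  have : Subsingleton ((F.obj j).obj M) := (subsingleton_ext_obj_iff n).2 (h j.unop.unop)
  have hy : y = (0 : (F.obj j).obj M) := this.elim _ _
  rw [hy]
  exact map_zero _

lemma subsingleton_ext_of_subsingleton_localCohomology_obj
    [h : Subsingleton ((localCohomology I n).obj M)]
    (hinj : ∀ t, (ht : I ^ t ≤ I ^ 1) → Function.Injective
      fun a : Abelian.Ext (ModuleCat.of A (A ⧸ I ^ 1)) M n ↦
        (Ext.mk₀ (ModuleCat.ofHom (Submodule.mapQ (I ^ t) (I ^ 1) LinearMap.id ht))).comp a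
          (zero_add n)) :
    Subsingleton (Abelian.Ext (ModuleCat.of A (A ⧸ I ^ 1)) M n) := by
  let F := localCohomology.diagram (localCohomology.idealPowersDiagram I) n
  let hc := isColimitOfPreserves ((evaluation _ _).obj M) (colimit.isColimit F)
  rw [← subsingleton_ext_obj_iff]
  refine subsingleton_of_forall_eq 0 fun x ↦ ?_
  let j : ℕᵒᵖᵒᵖ := .op (.op 1)
  obtain ⟨k, f, g, hfg⟩ := (Concrete.isColimit_rep_eq_iff_exists _ hc (i := j) (j := j) x
    (0 : (F.obj j).obj M)).1 (Subsingleton.elim (α := (localCohomology I n).obj M) _ _)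
  refine injective_ext_map n _ (hinj k.unop.unop
    ((localCohomology.idealPowersDiagram I).map f.unop).down.down) ?_
  rw [map_zero]
  exact hfg.trans (map_zero _)

end

section
variable {A : Type} [CommRing A]
open Abelian RingTheory.Sequence Pointwise ModuleCat

lemma subsingleton_ext_quotSMulTop {N M : ModuleCat.{0} A} {x : A} (hx : IsSMulRegular M x) {i : ℕ}
    (h₀ : Subsingleton (Abelian.Ext N M i)) (h₁ : Subsingleton (Abelian.Ext N M (i + 1))) :
    Subsingleton (Abelian.Ext N (ModuleCat.of A (QuotSMulTop x M)) i) := by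
  have zero1 := AddCommGrpCat.isZero_of_iff_subsingleton.mpr h₀
  have zero2 := AddCommGrpCat.isZero_of_iff_subsingleton.mpr h₁
  exact AddCommGrpCat.subsingleton_of_isZero <| ShortComplex.Exact.isZero_of_both_zeros
    ((Ext.covariant_sequence_exact₃' N hx.smulShortComplex_shortExact) i (i + 1) rfl)
    (zero1.eq_zero_of_src _) (zero2.eq_zero_of_tgt _)

/-- There is a weakly `M`-regular sequence of length `n` in `I`. -/
def HasWeaklyRegularSeq (I : Ideal A) (M : Type) [AddCommGroup M] [Module A M] (n : ℕ) : Prop :=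
  ∃ rs : List A, rs.length = n ∧ (∀ r ∈ rs, r ∈ I) ∧ IsWeaklyRegular M rs

lemma HasWeaklyRegularSeq.succ_iff {I : Ideal A} {M : Type} [AddCommGroup M] [Module A M] {n : ℕ} :
    HasWeaklyRegularSeq I M (n + 1) ↔
      ∃ x ∈ I, IsSMulRegular M x ∧ HasWeaklyRegularSeq I (QuotSMulTop x M) n := by
  constructor
  · rintro ⟨_ | ⟨x, rs⟩, hl, hmem, hreg⟩
    · simp at hl
    · rw [isWeaklyRegular_cons_iff] at hreg
      exact ⟨x, hmem x (by simp), hreg.1, rs, by simpa using hl,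
        fun r hr ↦ hmem r (by simp [hr]), hreg.2⟩
  · rintro ⟨x, hx, hreg, rs, hl, hmem, hrs⟩
    exact ⟨x :: rs, by simp [hl], by simpa [hx] using hmem, .cons hreg hrs⟩

lemma HasWeaklyRegularSeq.congr {I : Ideal A} {M N : Type} [AddCommGroup M] [Module A M]
    [AddCommGroup N] [Module A N] (e : M ≃ₗ[A] N) {n : ℕ} (h : HasWeaklyRegularSeq I M n) :
    HasWeaklyRegularSeq I N n := by
  obtain ⟨rs, hl, hmem, hreg⟩ := h
  exact ⟨rs, hl, hmem, (e.isWeaklyRegular_congr rs).1 hreg⟩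

lemma HasWeaklyRegularSeq.of_subsingleton_ext [IsNoetherianRing A] (I : Ideal A) (n : ℕ) :
    ∀ (M : ModuleCat.{0} A) [Module.Finite A M],
      (∀ i < n, Subsingleton (Abelian.Ext (ModuleCat.of A (A ⧸ I)) M i)) →
      HasWeaklyRegularSeq I M n := by
  induction n with
  | zero => exact fun M _ _ ↦ ⟨[], by simp⟩
  | succ n ih =>
    intro M _ h
    have : Subsingleton (ModuleCat.of A (A ⧸ I) ⟶ M) :=
      Ext.addEquiv₀.subsingleton_congr.mp (h 0 n.zero_lt_succ)
    have : Subsingleton (A ⧸ I →ₗ[A] M) :=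
      (homAddEquiv (M := ModuleCat.of A (A ⧸ I)) (N := M)).symm.subsingleton
    obtain ⟨x, mem_ann, hx⟩ := IsSMulRegular.subsingleton_linearMap_iff.mp this
    rw [Ideal.annihilator_quotient] at mem_ann
    exact succ_iff.2 ⟨x, mem_ann, hx, ih (ModuleCat.of A (QuotSMulTop x M))
      fun i hi ↦ subsingleton_ext_quotSMulTop hx (h i (by lia)) (h (i + 1) (by lia))⟩

lemma HasWeaklyRegularSeq.subsingleton_ext {I : Ideal A} (N : ModuleCat.{0} A) {t : ℕ}
    (hN : I ^ t ≤ Module.annihilator A N) {n : ℕ} : ∀ {M : ModuleCat.{0} A}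
      (_ : HasWeaklyRegularSeq I M n), ∀ i < n, Subsingleton (Abelian.Ext N M i) := by
  induction n with
  | zero => simp
  | succ n ih =>
    intro M h i hi
    obtain ⟨x, hxI, hx, hreg⟩ := succ_iff.1 h
    have hk : x ^ t ∈ Module.annihilator A N := hN (Ideal.pow_mem_pow hxI t)
    have mono_g : Mono (AddCommGrpCat.ofHom ((Ext.mk₀ (smulShortComplex M x).f).postcomp N
        (add_zero i))) := by
      cases i with
      | zero =>
        rw [AddCommGrpCat.mono_iff_injective]
        have := hx.smulShortComplex_shortExact.mono_f
        exact Ext.postcomp_mk₀_injective_of_mono N _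
      | succ i =>
        exact (Ext.covariant_sequence_exact₁' N hx.smulShortComplex_shortExact i (i + 1)
          rfl).mono_g ((AddCommGrpCat.isZero_of_iff_subsingleton.mpr
            (ih (M := ModuleCat.of A (QuotSMulTop x M)) hreg i (by lia))).eq_zero_of_src _)
    have mono_gk : Mono (AddCommGrpCat.ofHom ((Ext.mk₀ (M.smulShortComplex (x ^ t)).f).postcomp N
        (add_zero i))) := by
      simp only [smulShortComplex_f_eq_smul_id] at mono_g ⊢
      exact (Ext.postcomp_smul_id_mono_iff (x ^ t) i).mpr <|
        ((Ext.postcomp_smul_id_mono_iff x i).mp mono_g).pow t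
    have zero_gk : AddCommGrpCat.ofHom ((Ext.mk₀ (M.smulShortComplex (x ^ t)).f).postcomp N
        (add_zero i)) = 0 := by
      simp only [smulShortComplex_f_eq_smul_id]
      exact Ext.postcomp_smul_id_eq_zero_of_mem_annihilator hk i
    exact AddCommGrpCat.subsingleton_of_isZero (Limits.IsZero.of_mono_eq_zero _ zero_gk)

lemma HasWeaklyRegularSeq.quotSMulTop [IsNoetherianRing A] {I : Ideal A} {M : Type} [AddCommGroup M]
    [Module A M] [Module.Finite A M] {n : ℕ} (h : HasWeaklyRegularSeq I M (n + 1)) {x : A}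
    (hx : IsSMulRegular M x) : HasWeaklyRegularSeq I (QuotSMulTop x M) n := by
  have hI : I ^ 1 ≤ Module.annihilator A (ModuleCat.of A (A ⧸ I)) :=
    ((pow_one I).trans (Ideal.annihilator_quotient (I := I)).symm).le
  have hext : ∀ i < n + 1, Subsingleton (Abelian.Ext (of A (A ⧸ I)) (of A M) i) :=
    subsingleton_ext (M := of A M) (of A (A ⧸ I)) hI h
  have hquot (i : ℕ) (hi : i < n) :
      Subsingleton (Abelian.Ext (of A (A ⧸ I)) (of A (QuotSMulTop x M)) i) :=
    subsingleton_ext_quotSMulTop (M := of A M) hx (hext i (by lia)) (hext (i + 1) (by lia))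
  exact of_subsingleton_ext I n (of A (QuotSMulTop x M)) hquot

lemma HasWeaklyRegularSeq.injective_comp {I : Ideal A} {M : ModuleCat.{0} A} {n : ℕ}
    (h : HasWeaklyRegularSeq I M n) {t : ℕ} {N N' : ModuleCat.{0} A} (g : N ⟶ N') [Epi g]
    (hN : I ^ t ≤ Module.annihilator A N) :
    Function.Injective fun a : Abelian.Ext N' M n ↦ (Ext.mk₀ g).comp a (zero_add n) := by
  cases n with
  | zero => exact Ext.precomp_mk₀_injective_of_epi M g
  | succ n =>
    let S := ShortComplex.mk _ g (Limits.kernel.condition g)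
    have hS : S.ShortExact := { exact := ShortComplex.exact_kernel g }
    refine (injective_iff_map_eq_zero ((Ext.mk₀ g).precomp M (zero_add (n + 1)))).2 fun a ha ↦ ?_
    obtain ⟨b, rfl⟩ := Ext.contravariant_sequence_exact₃ hS M a ha (add_comm 1 n)
    have hk : Module.annihilator A N ≤ Module.annihilator A (Limits.kernel g : ModuleCat A) :=
      LinearMap.annihilator_le_of_injective (Limits.kernel.ι g).hom
        ((ModuleCat.mono_iff_injective _).1 inferInstance)
    have : Subsingleton (Abelian.Ext S.X₁ M n) := h.subsingleton_ext S.X₁ (hN.trans hk) n (by lia)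
    rw [Subsingleton.elim b 0, Ext.comp_zero]

lemma HasWeaklyRegularSeq.iff_subsingleton_localCohomology [IsNoetherianRing A] (I : Ideal A)
    (M : Type) [AddCommGroup M] [Module A M] [Module.Finite A M] (n : ℕ) :
    HasWeaklyRegularSeq I M n ↔
      ∀ i < n, Subsingleton ((localCohomology I i).obj (ModuleCat.of A M)) := by
  have ann (t : ℕ) : I ^ t ≤ Module.annihilator A (ModuleCat.of A (A ⧸ I ^ t)) := by
    simp [Ideal.annihilator_quotient]
  refine ⟨fun h i hi ↦ subsingleton_localCohomology_obj I _ i fun t ↦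
    h.subsingleton_ext (M := ModuleCat.of A M) _ (ann t) i hi, fun h ↦ ?_⟩
  induction n with
  | zero => exact ⟨[], by simp⟩
  | succ n ih =>
    specialize ih fun i hi ↦ h i (by lia)
    apply of_subsingleton_ext I (n + 1) (ModuleCat.of A M)
    intro i hi
    rw [← pow_one I]
    obtain hi | rfl := Nat.lt_succ_iff_lt_or_eq.1 hi
    · exact ih.subsingleton_ext (M := ModuleCat.of A M) _ (ann 1) i hi
    · have := h i (by lia)
      refine subsingleton_ext_of_subsingleton_localCohomology_obj I (ModuleCat.of A M) i
        fun t ht ↦ ?_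
      have : Epi (ModuleCat.ofHom (Submodule.mapQ (I ^ t) (I ^ 1) LinearMap.id
          (show I ^ t ≤ Submodule.comap LinearMap.id (I ^ 1) from ht))) := by
        rw [ModuleCat.epi_iff_surjective]
        rintro ⟨x⟩
        exact ⟨Submodule.Quotient.mk x, rfl⟩
      exact ih.injective_comp (M := ModuleCat.of A M) _ (ann t)

end

section
variable {A : Type} [CommRing A]
open RingTheory.Sequence IsLocalRing

lemma HasWeaklyRegularSeq.localizedModule {I : Ideal A} {M : Type} [AddCommGroup M] [Module A M]
    {n : ℕ} (h : HasWeaklyRegularSeq I M n) {P : Ideal A} [P.IsPrime] (hP : I ≤ P) :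
    HasWeaklyRegularSeq (maximalIdeal (Localization.AtPrime P))
      (LocalizedModule P.primeCompl M) n := by
  obtain ⟨rs, hl, hmem, hreg⟩ := h
  refine ⟨rs.map (algebraMap A _), by simpa, ?_, hreg.of_isLocalizedModule _ P.primeCompl
    (LocalizedModule.mkLinearMap P.primeCompl M)⟩
  rw [List.forall_mem_map]
  exact fun r hr ↦ (IsLocalization.AtPrime.to_map_mem_maximal_iff _ P r).2 (hP (hmem r hr))

/-- Localization commutes with the quotient by a principal ideal. -/
noncomputable def quotSMulTopLocalizedModuleEquiv (S : Submonoid A) (M : Type) [AddCommGroup M]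
    [Module A M] (x : A) :
    QuotSMulTop (algebraMap A (Localization S) x) (LocalizedModule S M) ≃ₗ[Localization S]
      LocalizedModule S (QuotSMulTop x M) :=
  (QuotSMulTop.congr (algebraMap A (Localization S) x)
    (IsLocalizedModule.isBaseChange S (Localization S)
      (LocalizedModule.mkLinearMap S M)).equiv).symm ≪≫ₗ
  QuotSMulTop.algebraMapTensorEquivTensorQuotSMulTop x M (Localization S) ≪≫ₗ
  (IsLocalizedModule.isBaseChange S (Localization S)
    (LocalizedModule.mkLinearMap S (QuotSMulTop x M))).equiv

lemma exists_isSMulRegular_mem_of_localizedModule [IsNoetherianRing A] (I : Ideal A) (M : Type)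
    [AddCommGroup M] [Module A M] [Module.Finite A M]
    (h : ∀ (P : Ideal A) [P.IsPrime], I ≤ P → ∃ y ∈ maximalIdeal (Localization.AtPrime P),
      IsSMulRegular (LocalizedModule P.primeCompl M) y) :
    ∃ x ∈ I, IsSMulRegular M x := by
  have : Subsingleton (A ⧸ I →ₗ[A] M) := by
    by_contra! hne
    obtain ⟨f, hf⟩ := exists_ne (0 : A ⧸ I →ₗ[A] M)
    obtain ⟨z, hz⟩ := DFunLike.ne_iff.1 hf
    obtain ⟨P, hass, hle⟩ := exists_le_isAssociatedPrime_of_isNoetherianRing A (f z) hz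
    have hIP : I ≤ P := fun r hr ↦ hle <| by
      have hrz : r • z = 0 := Module.mem_annihilator.1
        ((Ideal.annihilator_quotient (I := I)).symm ▸ hr) z
      simp [Submodule.mem_colon_singleton, ← map_smul, hrz]
    obtain ⟨hprime, m, hm⟩ := isAssociatedPrime_iff.1 hass
    obtain ⟨y, hy, hreg⟩ := h P hIP
    let g := LocalizedModule.mkLinearMap P.primeCompl M
    have hmax : maximalIdeal (Localization.AtPrime P) ≤
        LinearMap.ker (LinearMap.toSpanSingleton (Localization.AtPrime P) _ (g m)) := by
      rw [← Localization.AtPrime.map_eq_maximalIdeal, Ideal.map_le_iff_le_comap]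
      intro r hr
      have hrm : r • m = 0 := by simpa [hm, Submodule.mem_colon_singleton] using hr
      simp [← map_smul, hrm]
    have hgm : g m = 0 := hreg (by simpa using hmax hy)
    obtain ⟨s, hs⟩ := (IsLocalizedModule.eq_zero_iff P.primeCompl g).1 hgm
    exact s.2 (by simpa [hm, Submodule.mem_colon_singleton] using (Submonoid.smul_def s m).symm.trans hs)
  simpa [Ideal.annihilator_quotient] using IsSMulRegular.subsingleton_linearMap_iff.1 this

lemma HasWeaklyRegularSeq.of_localizedModule [IsNoetherianRing A] (I : Ideal A) (n : ℕ) :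
    ∀ (M : Type) [AddCommGroup M] [Module A M] [Module.Finite A M],
      (∀ (P : Ideal A) [P.IsPrime], I ≤ P →
        HasWeaklyRegularSeq (maximalIdeal (Localization.AtPrime P))
          (LocalizedModule P.primeCompl M) n) →
      HasWeaklyRegularSeq I M n := by
  induction n with
  | zero => exact fun M _ _ _ _ ↦ ⟨[], by simp⟩
  | succ n ih =>
    intro M _ _ _ h
    obtain ⟨x, hxI, hx⟩ := exists_isSMulRegular_mem_of_localizedModule I M fun P _ hP ↦
      let ⟨y, hy, hreg, _⟩ := succ_iff.1 (h P hP)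
      ⟨y, hy, hreg⟩
    refine succ_iff.2 ⟨x, hxI, hx, ih _ fun P _ hP ↦ ?_⟩
    have hxP : IsSMulRegular (LocalizedModule P.primeCompl M)
        (algebraMap A (Localization.AtPrime P) x) :=
      hx.of_isLocalizedModule _ P.primeCompl (LocalizedModule.mkLinearMap P.primeCompl M)
    exact ((h P hP).quotSMulTop hxP).congr (quotSMulTopLocalizedModuleEquiv P.primeCompl M x)

lemma natCast_le_sInf_nontrivial_iff [IsNoetherianRing A] (I : Ideal A)
    (M : Type) [AddCommGroup M] [Module A M] [Module.Finite A M] (n : ℕ) :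
    (n : ℕ∞) ≤ sInf {n : ℕ∞ | ∃ m : ℕ, n = (m : ℕ∞) ∧
        Nontrivial ((localCohomology I m).obj (ModuleCat.of A M))} ↔
      HasWeaklyRegularSeq I M n := by
  rw [HasWeaklyRegularSeq.iff_subsingleton_localCohomology, le_sInf_iff]
  constructor
  · intro h i hi
    by_contra! hne
    exact hi.not_ge (by exact_mod_cast h i ⟨i, rfl, hne⟩)
  · rintro h _ ⟨i, rfl, hne⟩
    by_contra! hi
    exact not_subsingleton_iff_nontrivial.2 hne (h i (by exact_mod_cast hi))

end

/-- **Depth and local cohomology.**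
Let `A` be a Noetherian commutative ring, `M` a finitely generated `A`-module and
`I` an ideal of `A`.  Then `depth_A(I, M)` equals the infimum of the set of
integers `n` such that the local cohomology module `H^n_I(M)` is nonzero. -/
theorem idealDepth_eq_sInf_localCohomology_nontrivial
    (A : Type) [CommRing A] [IsNoetherianRing A] (I : Ideal A)
    (M : Type) [AddCommGroup M] [Module A M] [Module.Finite A M] :
    idealDepth A I M =
      sInf {n : ℕ∞ | ∃ m : ℕ, n = (m : ℕ∞) ∧
        Nontrivial ((localCohomology I m).obj (ModuleCat.of A M))} := by
  refine ENat.eq_of_forall_natCast_le_iff fun n ↦ ?_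
  rw [natCast_le_sInf_nontrivial_iff, idealDepth, le_sInf_iff]
  constructor
  · intro h
    refine .of_localizedModule I n M fun P hP hIP ↦ ?_
    exact (natCast_le_sInf_nontrivial_iff _ _ n).1 (h _ ⟨P, hP, hIP, rfl⟩)
  · rintro h _ ⟨P, hP, hIP, rfl⟩
    exact (natCast_le_sInf_nontrivial_iff _ _ n).2 (h.localizedModule hIP)
end

section
/- Let B be a Noetherian local ring and M a finite B-module satisfying Serre's condition (S_n). If there is a minimal prime P of (the support of) M with dim B/P < n, then dim B/P = depth M = dim M. If moreover M satisfies (S'_n), then dim B/P = dim B. -/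
open CategoryTheory

/-- `dim A_P`, the height of the prime `P`. -/
noncomputable def primeKrullDim (A : Type) [CommRing A] (P : Ideal A)
    (hP : P.IsPrime) : WithBot ℕ∞ :=
  haveI := hP
  ringKrullDim (Localization.AtPrime P)

/-- `dim M_P`, the dimension of the localized module. -/
noncomputable def primeModuleDim (A : Type) [CommRing A] (P : Ideal A)
    (hP : P.IsPrime) (M : Type) [AddCommGroup M] [Module A M] : WithBot ℕ∞ :=
  haveI := hP
  Order.krullDim
    (Module.support (Localization.AtPrime P) (LocalizedModule P.primeCompl M))

/-- Serre's condition `(S_n)`: `depth M_P ≥ min (n, dim M_P)` for all primes `P`. -/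
def SerreS (A : Type) [CommRing A] (M : Type) [AddCommGroup M] [Module A M]
    (n : ℕ) : Prop :=
  ∀ (P : Ideal A) (hP : P.IsPrime),
    min (n : WithBot ℕ∞) (primeModuleDim A P hP M) ≤
      (primeLocalDepth A P hP M : WithBot ℕ∞)

/-- Serre's condition `(S'_n)`: `depth M_P ≥ min (n, dim A_P)` for all primes `P`. -/
def SerreS' (A : Type) [CommRing A] (M : Type) [AddCommGroup M] [Module A M]
    (n : ℕ) : Prop :=
  ∀ (P : Ideal A) (hP : P.IsPrime),
    min (n : WithBot ℕ∞) (primeKrullDim A P hP) ≤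
      (primeLocalDepth A P hP M : WithBot ℕ∞)

open Limits RingTheory.Sequence

universe u

lemma ModuleCat.mono_homologyMap {R : Type u} [Ring R] {ι : Type*} {c : ComplexShape ι}
    {K L : HomologicalComplex (ModuleCat.{u} R) c} (φ : K ⟶ L) (i j k : ι) (hi : c.prev j = i)
    (hk : c.next j = k)
    (h : ∀ (x : K.X j) (y : L.X i), K.d j k x = 0 → φ.f j x = L.d i j y → ∃ z, K.d i j z = x) :
    Mono (HomologicalComplex.homologyMap φ j) := by
  rw [HomologicalComplex.mono_homologyMap_iff_up_to_refinements φ i j k hi hk]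
  intro A x hx y hy
  have H : ∀ a : A, ∃ z, K.d i j z = x a := fun a ↦ h (x a) (y a)
    (by simpa using congr($hx a)) (by simpa using congr($hy a))
  choose z hz using H
  refine ⟨ModuleCat.of R (A →₀ R), ModuleCat.ofHom (Finsupp.linearCombination R id), ?_,
    ModuleCat.ofHom (Finsupp.linearCombination R z), ?_⟩
  · rw [ModuleCat.epi_iff_surjective]
    exact Finsupp.linearCombination_id_surjective R A
  · ext a
    simp [hz]

open HomologicalComplex in
lemma HomologicalComplex.epi_homologyMap_of_mono_unop {V : Type*} [Category* V] [Abelian V]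
    {ι : Type*} {c : ComplexShape ι} {K L : HomologicalComplex Vᵒᵖ c} (φ : K ⟶ L) (i : ι)
    (h : Mono (homologyMap ((unopFunctor V c).map φ.op) i)) : Epi (homologyMap φ i) := by
  let ψ := (unopFunctor V c).map φ.op
  have : Mono (homologyMap ψ i) := h
  have key := (Iso.eq_comp_inv (homologyOp _ i)).2 (homologyOp_hom_naturality ψ i)
  have hepi : Epi (((homologyOp _ i).hom ≫ (homologyMap ψ i).op) ≫ (homologyOp _ i).inv) :=
    inferInstance
  have epi_of_eq : ∀ {A B : Vᵒᵖ} {f g : A ⟶ B}, f = g → Epi g → Epi f := by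
    rintro _ _ _ _ rfl h
    exact h
  exact epi_of_eq key hepi

namespace CategoryTheory.ProjectiveResolution

section

variable {R : Type*} [Ring R] {C : Type*} [Category* C] [Abelian C] [Linear R C]
  [EnoughProjectives C]

open HomologicalComplex in
lemma mono_Ext_map {X X' : C} (P : ProjectiveResolution X) (P' : ProjectiveResolution X')
    (f : X' ⟶ X) (φ : P'.complex ⟶ P.complex)
    (hφ : φ ≫ P.π = P'.π ≫ (ChainComplex.single₀ C).map f) (n : ℕ) (Y : C)
    (h : Mono (homologyMap (K := P.complex.linearYonedaObj R Y)
      (L := P'.complex.linearYonedaObj R Y)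
      ((unopFunctor _ _).map
      ((((linearYoneda R C).obj Y).rightOp.mapHomologicalComplex _).map φ).op) n)) :
    Mono (((Ext R C n).map f.op).app Y) := by
  have h2 : ((Ext R C n).map f.op).app Y =
    ((((linearYoneda R C).obj Y).rightOp.leftDerived n).map f).unop := rfl
  rw [h2, Functor.leftDerived_map_eq _ n f φ hφ]
  have := epi_homologyMap_of_mono_unop _ n h
  exact @unop_mono_of_epi _ _ _ _ _ <| epi_comp' inferInstance <|
    epi_comp' (show Epi (homologyMap _ n) from this) inferInstance

end

variable {C : Type*} [Category* C] [Abelian C] [HasExt.{u} C] {X Y : C}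

lemma extMk_eq_zero_iff_exists_s3 (P : ProjectiveResolution X) {n : ℕ}
    (f : P.complex.X n ⟶ Y) (hf : P.complex.d (n + 1) n ≫ f = 0) :
    P.extMk f (n + 1) rfl hf = 0 ↔
      ∃ g : P.complex.X ((ComplexShape.down ℕ).next n) ⟶ Y, P.complex.d n _ ≫ g = f := by
  obtain _ | n := n
  · refine ⟨fun h ↦ ⟨0, ?_⟩, ?_⟩
    · rw [← P.extEquivCohomologyClass.apply_eq_iff_eq, extEquivCohomologyClass_extMk,
        extEquivCohomologyClass_zero, CochainComplex.HomComplex.CohomologyClass.mk_eq_zero_iff,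
        CochainComplex.HomComplex.Cocycle.toSingleMk_mem_coboundaries_iff _ _ _ _ _ 1
          (by simp)] at h
      obtain ⟨g, hg⟩ := h
      have : g = 0 := (CochainComplex.isZero_of_isStrictlyLE P.cochainComplex 0 1).eq_of_src _ _
      rw [this, comp_zero] at hg
      rw [← cancel_epi (P.cochainComplexXIso (-(0 : ℕ)) 0 rfl).hom, ← hg, comp_zero, comp_zero]
    · rintro ⟨g, rfl⟩
      simp
  · rw [P.extMk_eq_zero_iff _ _ _ _ n rfl]
    rw [(ComplexShape.down ℕ).next_eq' (i := n + 1) (j := n) rfl]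

end CategoryTheory.ProjectiveResolution

section
open ProjectiveResolution
variable {R : Type u} [CommRing R] {X X' : ModuleCat.{u} R} (n : ℕ) (Y : ModuleCat.{u} R)

lemma ModuleCat.isZero_Ext_iff :
    IsZero (((Ext R (ModuleCat.{u} R) n).obj (.op X)).obj Y) ↔
      Subsingleton (Abelian.Ext.{u} X Y n) := by
  let P : ProjectiveResolution X := .of X
  rw [(P.isoExt (R := R) n Y).isZero_iff, ← HomologicalComplex.exactAt_iff_isZero_homology,
    HomologicalComplex.exactAt_iff' _ _ _ _ rfl (by simp : _ = n + 1),
    ShortComplex.moduleCat_exact_iff, subsingleton_iff_forall_eq 0]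
  refine ⟨fun h α ↦ ?_, fun h (x : P.complex.X n ⟶ Y) hx ↦ ?_⟩
  · obtain ⟨x, hx, rfl⟩ := P.extMk_surjective α (n + 1) rfl
    exact (P.extMk_eq_zero_iff_exists_s3 x hx).2 (h x hx)
  · exact (P.extMk_eq_zero_iff_exists_s3 x hx).1 (h _)

lemma ModuleCat.mono_Ext_map (f : X' ⟶ X)
    (h : Function.Injective ((Abelian.Ext.mk₀.{u} f).precomp Y (zero_add n))) :
    Mono (((Ext R (ModuleCat.{u} R) n).map f.op).app Y) := by
  let P : ProjectiveResolution X := .of X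
  let P' : ProjectiveResolution X' := .of X'
  let φ := ProjectiveResolution.lift f P' P
  have hφ := ProjectiveResolution.lift_commutes f P' P
  refine ProjectiveResolution.mono_Ext_map P P' f φ hφ n Y ?_
  refine ModuleCat.mono_homologyMap _ _ n (n + 1) rfl (by simp) ?_
  intro (x : P.complex.X n ⟶ Y) y hx hy
  change P.complex.d _ _ ≫ x = 0 at hx
  change φ.f n ≫ x = P'.complex.d n ((ComplexShape.down ℕ).next n) ≫ y at hy
  change ∃ z : P.complex.X ((ComplexShape.down ℕ).next n) ⟶ Y,
    P.complex.d n _ ≫ z = x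
  rw [← P.extMk_eq_zero_iff_exists_s3 x hx, ← map_eq_zero_iff _ h]
  change (Abelian.Ext.mk₀ f).comp _ (zero_add _) = _
  rw [mk₀_comp_extMk (R' := P') x _ rfl hx ⟨φ, congr(($hφ).f 0)⟩, extMk_eq_zero_iff_exists_s3]
  exact ⟨y, hy.symm⟩

end

namespace localCohomology

variable {R : Type} [CommRing R] (I : Ideal R) (i : ℕ) (M : ModuleCat.{0} R)

lemma subsingleton_of_subsingleton_ext
    (h : ∀ t, Subsingleton (Abelian.Ext.{0} (ModuleCat.of R (R ⧸ I ^ t)) M i)) :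
    Subsingleton ((localCohomology I i).obj M) := by
  let F := diagram (idealPowersDiagram I) i
  have hc := isColimitOfPreserves ((evaluation _ _).obj M) (colimit.isColimit F)
  refine subsingleton_of_forall_eq 0 fun x ↦ ?_
  obtain ⟨j, y, rfl⟩ := Concrete.isColimit_exists_rep _ hc x
  have : Subsingleton ((F.obj j).obj M) :=
    ModuleCat.subsingleton_of_isZero ((ModuleCat.isZero_Ext_iff i M).2 (h j.unop.unop))
  have hy : y = 0 := Subsingleton.elim (α := (F.obj j).obj M) _ _
  rw [hy]
  exact map_zero _

/-- The projection `R ⧸ I ^ m → R ⧸ I ^ k` for `k ≤ m`. -/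
abbrev powProj {k m : ℕ} (h : k ≤ m) : ModuleCat.of R (R ⧸ I ^ m) ⟶ ModuleCat.of R (R ⧸ I ^ k) :=
  ModuleCat.ofHom (Submodule.mapQ _ _ LinearMap.id (Ideal.pow_le_pow_right h))

lemma subsingleton_ext_of_subsingleton (k : ℕ)
    (h : ∀ m (hm : k ≤ m), Function.Injective
      ((Abelian.Ext.mk₀.{0} (powProj I hm)).precomp M (zero_add i)))
    (h0 : Subsingleton ((localCohomology I i).obj M)) :
    Subsingleton (Abelian.Ext.{0} (ModuleCat.of R (R ⧸ I ^ k)) M i) := by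
  let F := diagram (idealPowersDiagram I) i
  have hc := isColimitOfPreserves ((evaluation _ _).obj M) (colimit.isColimit F)
  rw [← ModuleCat.isZero_Ext_iff, ModuleCat.isZero_iff_subsingleton]
  refine subsingleton_of_forall_eq 0 fun x ↦ ?_
  have : IsFiltered (ℕᵒᵖ)ᵒᵖ := inferInstance
  obtain ⟨j, f, hf⟩ := (IsColimit.eq_iff' hc (i := .op (.op k)) x 0).1
    (Subsingleton.elim (α := (localCohomology I i).obj M) _ _)
  have hm : k ≤ j.unop.unop := f.unop.unop.le
  have := ModuleCat.mono_Ext_map i M _ (h _ hm)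
  rw [ModuleCat.mono_iff_injective] at this
  exact this hf

end localCohomology

lemma Module.support_subset_zeroLocus_of_pow_le_annihilator {R M : Type*} [CommRing R]
    [AddCommGroup M] [Module R M] [Module.Finite R M] {I : Ideal R} {m : ℕ}
    (h : I ^ m ≤ Module.annihilator R M) : Module.support R M ⊆ PrimeSpectrum.zeroLocus I := by
  rw [Module.support_eq_zeroLocus]
  intro p hp
  have : I ^ m ≤ p.asIdeal := h.trans hp
  exact Ideal.IsPrime.le_of_pow_le this

namespace localCohomology

variable {R : Type} [CommRing R] [IsNoetherianRing R] {I : Ideal R} {M : Type} [AddCommGroup M]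
  [Module R M] [Module.Finite R M]

lemma injective_precomp_powProj (hI : I • (⊤ : Submodule R M) < ⊤) {rs : List R}
    (mem : ∀ r ∈ rs, r ∈ I) (reg : IsRegular M rs) {k m : ℕ} (h : k ≤ m) :
    Function.Injective ((Abelian.Ext.mk₀.{0} (powProj I h)).precomp (ModuleCat.of R M)
      (zero_add rs.length)) := by
  have hsurj : Function.Surjective (powProj I h).hom := Submodule.factor_surjective
    (Ideal.pow_le_pow_right h)
  let S := (powProj I h).hom.shortComplexKer
  have hS : S.ShortExact := LinearMap.shortExact_shortComplexKer hsurj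
  rw [injective_iff_map_eq_zero]
  intro x hx
  obtain hn | ⟨n, hn⟩ : rs.length = 0 ∨ ∃ n, 1 + n = rs.length := by
    cases rs with
    | nil => simp
    | cons a l => exact .inr ⟨l.length, by simp [add_comm]⟩
  · generalize rs.length = l at x hn
    subst hn
    have : Epi (powProj I h) := (ModuleCat.epi_iff_surjective _).2 hsurj
    exact (injective_iff_map_eq_zero _).1 (Abelian.Ext.precomp_mk₀_injective_of_epi _ _) x hx
  · obtain ⟨y, rfl⟩ := Abelian.Ext.contravariant_sequence_exact₃ hS _ x hx hn
    have hfin : Module.Finite R S.X₁ := inferInstanceAs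
      (Module.Finite R (LinearMap.ker (powProj I h).hom))
    have hsupp : Module.support R S.X₁ ⊆ PrimeSpectrum.zeroLocus I := by
      refine Module.support_subset_zeroLocus_of_pow_le_annihilator (m := m) ?_
      intro r hr
      rw [Module.mem_annihilator]
      rintro ⟨z, hz⟩
      refine Subtype.ext ?_
      obtain ⟨z, rfl⟩ := Ideal.Quotient.mk_surjective z
      exact Ideal.Quotient.eq_zero_iff_mem.2 (Ideal.mul_mem_right _ _ hr)
    have := ModuleCat.subsingleton_ext_of_exists_isRegular I S.X₁ hsupp (ModuleCat.of R M) hI rs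
      mem reg n (by lia)
    rw [Subsingleton.elim y 0]
    simp

lemma exists_isRegular_iff (hI : I • (⊤ : Submodule R M) < ⊤) (k : ℕ) :
    (∀ i < k, Subsingleton ((localCohomology I i).obj (ModuleCat.of R M))) ↔
      ∃ rs : List R, rs.length = k ∧ (∀ r ∈ rs, r ∈ I) ∧ IsRegular M rs := by
  constructor
  · intro h
    have rees (k : ℕ) := ModuleCat.exists_isRegular_of_exists_subsingleton_ext.{0} I k
      (ModuleCat.of R M) hI (ModuleCat.of R (R ⧸ I ^ 1)) (by
        rw [Module.support_eq_zeroLocus, Ideal.annihilator_quotient, pow_one])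
    refine rees k fun i ↦ ?_
    induction i using Nat.strong_induction_on with
    | _ i ih =>
      intro hi
      obtain ⟨rs, rfl, mem, reg⟩ := rees i fun j hj ↦ ih j hj (hj.trans hi)
      exact subsingleton_ext_of_subsingleton I _ _ 1
        (fun m hm ↦ injective_precomp_powProj hI mem reg hm) (h _ hi)
  · rintro ⟨rs, rfl, mem, reg⟩ i hi
    refine subsingleton_of_subsingleton_ext I i _ fun t ↦ ?_
    refine ModuleCat.subsingleton_ext_of_exists_isRegular I _ ?_ _ hI rs mem reg i hi
    refine Module.support_subset_zeroLocus_of_pow_le_annihilator (m := t) ?_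
    rw [Ideal.annihilator_quotient]

end localCohomology

lemma Module.supportDim_le_of_algebraMap_bijective {R S N : Type*} [CommRing R] [CommRing S]
    [Algebra R S] [AddCommGroup N] [Module R N] [Module S N] [IsScalarTower R S N]
    (h : Function.Bijective (algebraMap R S)) :
    Module.supportDim R N ≤ Module.supportDim S N := by
  let e : R ≃+* S := RingEquiv.ofBijective (algebraMap R S) h
  let g := PrimeSpectrum.comapEquiv e
  refine Order.krullDim_le_of_strictMono (fun p ↦ ⟨g p.1, ?_⟩) fun a b hab ↦
    g.strictMono hab
  obtain ⟨m, hm⟩ := Module.mem_support_iff'.1 p.2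
  refine Module.mem_support_iff'.2 ⟨m, fun s hs ↦ ?_⟩
  rw [← e.apply_symm_apply s]
  change algebraMap R S (e.symm s) • m ≠ 0
  rw [algebraMap_smul]
  exact hm _ hs

open Submodule Pointwise in
lemma IsAssociatedPrime.exists_gt_quotSMulTop {R M : Type*} [CommRing R] [IsNoetherianRing R]
    [IsLocalRing R] [AddCommGroup M] [Module R M] [Module.Finite R M] {P : Ideal R}
    (hP : IsAssociatedPrime P M) {x : R} (hx : x ∈ IsLocalRing.maximalIdeal R)
    (hreg : IsSMulRegular M x) :
    ∃ Q, IsAssociatedPrime Q (QuotSMulTop x M) ∧ P ≤ Q ∧ x ∈ Q ∧ x ∉ P := by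
  obtain ⟨hprime, m, hm⟩ := isAssociatedPrime_iff.1 hP
  have hmem (r : R) : r ∈ P ↔ r • m = 0 := by simp [hm]
  let N : Submodule R M := torsionBySet R M P
  let N' : Submodule R (QuotSMulTop x M) := N.map (mkQ _)
  have hN' : N' ≠ ⊥ := by
    intro h0
    have hle : N ≤ IsLocalRing.maximalIdeal R • N := by
      intro y hy
      have : mkQ (x • (⊤ : Submodule R M)) y = 0 := by
        rw [← mem_bot R, ← h0]
        exact mem_map_of_mem hy
      obtain ⟨z, -, rfl⟩ := (mem_smul_pointwise_iff_exists _ _ _).1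
        ((Submodule.Quotient.mk_eq_zero _).1 this)
      refine smul_mem_smul hx ?_
      rw [mem_torsionBySet_iff] at hy ⊢
      intro a
      refine hreg ?_
      simp only [smul_zero]
      rw [smul_comm]
      exact hy a
    have hbot := eq_bot_of_le_smul_of_le_jacobson_bot _ _ (IsNoetherian.noetherian N) hle
      (IsLocalRing.maximalIdeal_le_jacobson _)
    have hmN : m ∈ N := (mem_torsionBySet_iff _ _).2 fun a ↦ (hmem a).1 a.2
    rw [hbot, mem_bot] at hmN
    exact hprime.ne_top ((Ideal.eq_top_iff_one _).2 ((hmem 1).2 (by simp [hmN])))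
  have : Nontrivial N' := nontrivial_iff_ne_bot.2 hN'
  obtain ⟨Q, hQ⟩ := associatedPrimes.nonempty R N'
  have hann := hQ.annihilator_le
  refine ⟨Q, hQ.map_of_injective N'.subtype N'.subtype_injective, fun p hp ↦ hann ?_, hann ?_,
    fun hxP ↦ ?_⟩
  · rw [mem_annihilator]
    rintro ⟨_, y, hy, rfl⟩ -
    refine Subtype.ext ?_
    change p • mkQ _ y = 0
    rw [← map_smul, (mem_torsionBySet_iff _ _).1 hy ⟨p, hp⟩, map_zero]
  · rw [mem_annihilator]
    rintro ⟨_, y, hy, rfl⟩ -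
    refine Subtype.ext ?_
    change x • mkQ _ y = 0
    rw [← map_smul]
    exact (Submodule.Quotient.mk_eq_zero _).2 (smul_mem_pointwise_smul _ _ _ mem_top)
  · have : m = 0 := hreg (by simpa using (hmem x).1 hxP)
    exact hprime.ne_top ((Ideal.eq_top_iff_one _).2 ((hmem 1).2 (by simp [this])))

lemma IsAssociatedPrime.length_le_ringKrullDim_quotient {R : Type*} [CommRing R]
    [IsNoetherianRing R] [IsLocalRing R] (rs : List R)
    (mem : ∀ r ∈ rs, r ∈ IsLocalRing.maximalIdeal R) {M : Type*} [AddCommGroup M] [Module R M]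
    [Module.Finite R M] {P : Ideal R} (hP : IsAssociatedPrime P M) (reg : IsWeaklyRegular M rs) :
    (rs.length : WithBot ℕ∞) ≤ ringKrullDim (R ⧸ P) := by
  have := hP.isPrime
  induction rs generalizing M P with
  | nil => simpa using ringKrullDim_nonneg_of_nontrivial
  | cons x rs ih =>
    rw [isWeaklyRegular_cons_iff] at reg
    obtain ⟨Q, hQ, hPQ, hxQ, hxP⟩ := hP.exists_gt_quotSMulTop (mem x (by simp)) reg.1
    calc ((x :: rs).length : WithBot ℕ∞) = rs.length + 1 := by simp
      _ ≤ ringKrullDim (R ⧸ Q) + 1 :=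
        add_le_add_left (ih (fun r hr ↦ mem r (by simp [hr])) hQ reg.2 hQ.isPrime) 1
      _ ≤ ringKrullDim (R ⧸ P) :=
        ringKrullDim_succ_le_of_surjective (Ideal.Quotient.factor hPQ)
          (Ideal.Quotient.factor_surjective hPQ) (r := Ideal.Quotient.mk P x)
          (mem_nonZeroDivisors_of_ne_zero (by rwa [ne_eq, Ideal.Quotient.eq_zero_iff_mem]))
          (by simpa [Ideal.Quotient.eq_zero_iff_mem] using hxQ)

lemma IsLocalRing.maximalIdeal_smul_top_lt_top (R M : Type*) [CommRing R] [IsLocalRing R]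
    [AddCommGroup M] [Module R M] [Module.Finite R M] [Nontrivial M] :
    maximalIdeal R • (⊤ : Submodule R M) < ⊤ :=
  (Submodule.top_ne_ideal_smul_of_le_jacobson_annihilator
    (maximalIdeal_le_jacobson _)).symm.lt_top

lemma natCast_le_localDepth_iff {A M : Type} [CommRing A] [IsNoetherianRing A] [IsLocalRing A]
    [AddCommGroup M] [Module A M] [Module.Finite A M] [Nontrivial M] (k : ℕ) :
    (k : ℕ∞) ≤ localDepth A M ↔ ∃ rs : List A, rs.length = k ∧
      (∀ r ∈ rs, r ∈ IsLocalRing.maximalIdeal A) ∧ IsRegular M rs := by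
  rw [← localCohomology.exists_isRegular_iff (IsLocalRing.maximalIdeal_smul_top_lt_top A M),
    localDepth, le_sInf_iff]
  constructor
  · intro h i hi
    by_contra hn
    exact hi.not_ge (by exact_mod_cast h i ⟨i, rfl, not_subsingleton_iff_nontrivial.1 hn⟩)
  · rintro h _ ⟨m, rfl, hm⟩
    by_contra! hlt
    exact not_subsingleton_iff_nontrivial.2 hm (h m (by exact_mod_cast hlt))

lemma localDepth_le_of_algebraMap_bijective {A A' M M' : Type} [CommRing A] [IsNoetherianRing A]
    [IsLocalRing A] [CommRing A'] [IsNoetherianRing A'] [IsLocalRing A'] [Algebra A A']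
    [AddCommGroup M] [Module A M] [Module.Finite A M] [Nontrivial M]
    [AddCommGroup M'] [Module A M'] [Module A' M'] [IsScalarTower A A' M'] [Module.Finite A' M']
    (h : Function.Bijective (algebraMap A A')) (f : M ≃ₗ[A] M') :
    localDepth A' M' ≤ localDepth A M := by
  have : Nontrivial M' := f.toEquiv.symm.nontrivial
  rw [← ENat.forall_natCast_le_iff_le]
  intro k hk
  rw [natCast_le_localDepth_iff] at hk ⊢
  obtain ⟨rs, rfl, mem, reg⟩ := hk
  let e : A ≃+* A' := RingEquiv.ofBijective (algebraMap A A') h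
  refine ⟨rs.map e.symm, by simp, ?_, ?_⟩
  · intro r hr
    obtain ⟨s, hs, rfl⟩ := List.mem_map.1 hr
    have := mem s hs
    rw [IsLocalRing.mem_maximalIdeal, mem_nonunits_iff] at this ⊢
    rwa [isUnit_map_iff]
  · refine (f.toAddEquiv.isRegular_congr (bs := rs) ?_).2 reg
    rw [List.forall₂_map_left_iff, List.forall₂_same]
    intro s _ x
    change f (e.symm s • x) = s • f x
    rw [map_smul, ← algebraMap_smul A' (e.symm s) (f x)]
    exact congr($(e.apply_symm_apply s) • f x)

section

open IsLocalRing

variable (B M : Type) [CommRing B] [IsLocalRing B] [AddCommGroup M] [Module B M]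

lemma IsLocalRing.primeCompl_maximalIdeal_le_isUnit :
    (maximalIdeal B).primeCompl ≤ IsUnit.submonoid B := fun x hx ↦ by
  simpa [Ideal.mem_primeCompl_iff, IsUnit.mem_submonoid_iff] using hx

lemma IsLocalRing.algebraMap_atPrime_maximalIdeal_bijective :
    Function.Bijective (algebraMap B (Localization.AtPrime (maximalIdeal B))) :=
  (IsLocalization.atUnits B (maximalIdeal B).primeCompl
    (primeCompl_maximalIdeal_le_isUnit B)).bijective

lemma IsLocalRing.mkLinearMap_maximalIdeal_bijective :
    Function.Bijective (LocalizedModule.mkLinearMap (maximalIdeal B).primeCompl M) := by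
  let S := (maximalIdeal B).primeCompl
  have : IsLocalization S B := IsLocalization.self (primeCompl_maximalIdeal_le_isUnit B)
  have : IsLocalizedModule S (LinearMap.id : M →ₗ[B] M) := isLocalizedModule_id S M B
  have h : (IsLocalizedModule.linearEquiv S LinearMap.id (LocalizedModule.mkLinearMap S M) :
      M →ₗ[B] LocalizedModule S M) = LocalizedModule.mkLinearMap S M := by
    ext m
    exact IsLocalizedModule.linearEquiv_apply S LinearMap.id (LocalizedModule.mkLinearMap S M) m
  rw [← h]
  exact LinearEquiv.bijective _

lemma primeLocalDepth_maximalIdeal_le [IsNoetherianRing B] [Module.Finite B M] [Nontrivial M] :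
    primeLocalDepth B (maximalIdeal B) inferInstance M ≤ localDepth B M := by
  have : Module.Finite (Localization.AtPrime (maximalIdeal B))
      (LocalizedModule (maximalIdeal B).primeCompl M) :=
    Module.Finite.of_isLocalizedModule (maximalIdeal B).primeCompl
      (LocalizedModule.mkLinearMap (maximalIdeal B).primeCompl M)
  exact localDepth_le_of_algebraMap_bijective (algebraMap_atPrime_maximalIdeal_bijective B)
    (LinearEquiv.ofBijective _ (mkLinearMap_maximalIdeal_bijective B M))

lemma supportDim_le_primeModuleDim_maximalIdeal :
    Module.supportDim B M ≤ primeModuleDim B (maximalIdeal B) inferInstance M := by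
  rw [Module.supportDim_eq_of_equiv
    (LinearEquiv.ofBijective _ (mkLinearMap_maximalIdeal_bijective B M))]
  exact Module.supportDim_le_of_algebraMap_bijective
    (algebraMap_atPrime_maximalIdeal_bijective B)

lemma primeKrullDim_maximalIdeal :
    primeKrullDim B (maximalIdeal B) inferInstance = ringKrullDim B :=
  (ringKrullDim_eq_of_ringEquiv (RingEquiv.ofBijective _
    (algebraMap_atPrime_maximalIdeal_bijective B))).symm

end

/-- **Ischebeck-type lemma.**
Let `B` be a Noetherian local ring and `M` a finite `B`-module satisfying `(S_n)`.
If there is a minimal prime `P` of (the support of) `M` with `dim B/P < n`, then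
`dim B/P = depth M = dim M`.  If moreover `M` satisfies `(S'_n)`, then
`dim B/P = dim B`. -/
theorem dim_quotient_eq_depth_of_minimal_support_prime
    (B : Type) [CommRing B] [IsNoetherianRing B] [IsLocalRing B]
    (M : Type) [AddCommGroup M] [Module B M] [Module.Finite B M]
    (n : ℕ) (hS : SerreS B M n)
    (P : Ideal B) (hP : P.IsPrime)
    (hmem : (⟨P, hP⟩ : PrimeSpectrum B) ∈ Module.support B M)
    (hmin : ∀ (Q : Ideal B) (hQ : Q.IsPrime), Q ≤ P →
      (⟨Q, hQ⟩ : PrimeSpectrum B) ∈ Module.support B M → Q = P)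
    (hdim : ringKrullDim (B ⧸ P) < (n : WithBot ℕ∞)) :
    (ringKrullDim (B ⧸ P) = (localDepth B M : WithBot ℕ∞) ∧
      (localDepth B M : WithBot ℕ∞) = Order.krullDim (Module.support B M)) ∧
    (SerreS' B M n → ringKrullDim (B ⧸ P) = ringKrullDim B) := by
  have : Nontrivial M := Module.nonempty_support_iff.1 ⟨_, hmem⟩
  have hann : Module.annihilator B M ≤ P := Module.annihilator_le_of_mem_support hmem
  have hass : IsAssociatedPrime P M :=
    Module.associatedPrimes.minimalPrimes_annihilator_subset_associatedPrimes B M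
      ⟨⟨hP, hann⟩, fun Q ⟨hQ, hQann⟩ hle ↦
        (hmin Q hQ hle (Module.mem_support_iff_of_finite.2 hQann)).ge⟩
  have hdepth : (localDepth B M : WithBot ℕ∞) ≤ ringKrullDim (B ⧸ P) := by
    obtain ⟨d, hd : (d : WithBot ℕ∞) = ringKrullDim (B ⧸ P)⟩ := WithBot.ne_bot_iff_exists.1
      (Order.bot_lt_krullDim (α := PrimeSpectrum (B ⧸ P))).ne'
    rw [← hd, WithBot.coe_le_coe, ← ENat.forall_natCast_le_iff_le]
    intro k hk
    obtain ⟨rs, rfl, mem, reg⟩ := (natCast_le_localDepth_iff k).1 hk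
    rw [← WithBot.coe_le_coe, hd]
    exact hass.length_le_ringKrullDim_quotient rs mem reg.toIsWeaklyRegular
  have hmax : ∀ a : WithBot ℕ∞, min (n : WithBot ℕ∞) a ≤
      primeLocalDepth B (IsLocalRing.maximalIdeal B) inferInstance M → a ≤ localDepth B M := by
    intro a ha
    have h : min (n : WithBot ℕ∞) a ≤ localDepth B M :=
      ha.trans (WithBot.coe_le_coe.2 (primeLocalDepth_maximalIdeal_le B M))
    exact (min_le_iff.1 h).resolve_left fun h ↦ ((h.trans hdepth).trans_lt hdim).false
  have hdimM : Module.supportDim B M ≤ localDepth B M :=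
    (supportDim_le_primeModuleDim_maximalIdeal B M).trans (hmax _ (hS _ _))
  have hquot : ringKrullDim (B ⧸ P) ≤ Module.supportDim B M := by
    rw [Module.supportDim_eq_ringKrullDim_quotient_annihilator]
    exact ringKrullDim_le_of_surjective (Ideal.Quotient.factor hann)
      (Ideal.Quotient.factor_surjective hann)
  refine ⟨⟨(hquot.trans hdimM).antisymm hdepth, (hdepth.trans hquot).antisymm hdimM⟩,
    fun hS' ↦ (ringKrullDim_quotient_le P).antisymm ?_⟩
  rw [← primeKrullDim_maximalIdeal]
  exact (hmax _ (hS' _ _)).trans hdepth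
end

section
/- Let R = ⊕_{λ ∈ ℤ^s} R_λ be a ℤ^s-graded Krull domain with a unique graded maximal ideal P (a maximal element among proper graded ideals) of height one (a 'homogeneous DVR'). Then P is a principal ideal. -/
/-- A subring `V` of a field `K` is a discrete valuation ring with fraction
field `K`: there is a nonzero non-unit `π ∈ V` such that every nonzero element
of `K` is a unit of `V` times an integer power of `π`. -/
def Subring.IsDVRWithFractionField {K : Type} [Field K] (V : Subring K) : Prop :=
  ∃ π : K, π ∈ V ∧ π ≠ 0 ∧ π⁻¹ ∉ V ∧
    ∀ x : K, x ≠ 0 → ∃ (u : K) (n : ℤ), u ∈ V ∧ u⁻¹ ∈ V ∧ x = u * π ^ n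

/-- A domain `R` is a Krull domain: there is a family of discrete valuation
subrings of its fraction field whose intersection is `R` and which has finite
character (every nonzero element of the fraction field is a unit in all but
finitely many members of the family). -/
def IsKrullDomain (R : Type) [CommRing R] [IsDomain R] : Prop :=
  ∃ (ι : Type) (V : ι → Subring (FractionRing R)),
    (∀ i, (V i).IsDVRWithFractionField) ∧
    (Set.range (algebraMap R (FractionRing R)) = ⋂ i, (V i : Set (FractionRing R))) ∧
    (∀ x : FractionRing R, x ≠ 0 → {i | ¬ (x ∈ V i ∧ x⁻¹ ∈ V i)}.Finite)

section Graded

variable {s : ℕ} {B : Type} [CommRing B] [IsDomain B]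
  (𝒜 : (Fin s → ℤ) → AddSubgroup B) [GradedRing 𝒜]

/-- The multiplicative set of nonzero homogeneous elements of a `ℤ^s`-graded
domain. -/
def homogeneousSubmonoid : Submonoid B where
  carrier := {x | x ≠ 0 ∧ ∃ lam : Fin s → ℤ, x ∈ 𝒜 lam}
  one_mem' := ⟨one_ne_zero, 0, SetLike.one_mem_graded 𝒜⟩
  mul_mem' := by
    rintro a b ⟨ha, i, hi⟩ ⟨hb, j, hj⟩
    exact ⟨mul_ne_zero ha hb, i + j, SetLike.mul_mem_graded hi hj⟩

/-- The ideal `P` has height one: every prime over `P` has height at least one,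
and some prime over `P` has height exactly one. -/
def IdealHeightOne (R : Type) [CommRing R] (P : Ideal R) : Prop :=
  (∀ (Q : Ideal R) (hQ : Q.IsPrime), P ≤ Q →
      1 ≤ Order.height (⟨Q, hQ⟩ : PrimeSpectrum R)) ∧
    ∃ (Q : Ideal R) (hQ : Q.IsPrime), P ≤ Q ∧
      Order.height (⟨Q, hQ⟩ : PrimeSpectrum R) = 1

/-- `P` is the unique graded ("`G`"-)maximal ideal: it is a proper homogeneous
ideal containing every proper homogeneous ideal. -/
def IsUniqueGradedMaximal (P : Ideal B) : Prop :=
  Ideal.IsHomogeneous 𝒜 P ∧ P ≠ ⊤ ∧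
    ∀ J : Ideal B, Ideal.IsHomogeneous 𝒜 J → J ≠ ⊤ → J ≤ P

end Graded

/-- The normalized valuation attached to a discrete valuation subring of a field. -/
theorem Subring.IsDVRWithFractionField.exists_valuation {K : Type} [Field K] {V : Subring K}
    (hV : V.IsDVRWithFractionField) :
    ∃ (π : K) (v : K → ℤ), π ≠ 0 ∧ v π = 1 ∧
      (∀ x y, x ≠ 0 → y ≠ 0 → v (x * y) = v x + v y) ∧ ∀ x, x ≠ 0 → (x ∈ V ↔ 0 ≤ v x) := by
  obtain ⟨π, hπ, hπ0, hπi, hfac⟩ := hV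
  have mem_iff : ∀ (u : K) (n : ℤ), u ∈ V → u⁻¹ ∈ V → u ≠ 0 → (u * π ^ n ∈ V ↔ 0 ≤ n) := by
    intro u n hu hui hu0
    refine ⟨fun h => ?_, fun h => ?_⟩
    · by_contra! hn
      apply hπi
      have h1 : π⁻¹ = u⁻¹ * (u * π ^ n) * π ^ (-n - 1).toNat := by
        rw [inv_mul_cancel_left₀ hu0, ← zpow_natCast, ← zpow_add₀ hπ0, ← zpow_neg_one]
        congr 1
        omega
      rw [h1]
      exact V.mul_mem (V.mul_mem hui h) (V.pow_mem hπ _)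
    · lift n to ℕ using h
      rw [zpow_natCast]
      exact V.mul_mem hu (V.pow_mem hπ _)
  have exponent_le : ∀ (u u' : K) (n m : ℤ), u ∈ V → u⁻¹ ∈ V → u ≠ 0 → u' ∈ V →
      u * π ^ n = u' * π ^ m → m ≤ n := by
    intro u u' n m hu hui hu0 hu' h
    have h1 : u * π ^ (n - m) = u' := by
      rw [zpow_sub₀ hπ0, ← mul_div_assoc, h, mul_div_cancel_right₀ _ (zpow_ne_zero _ hπ0)]
    have := (mem_iff u (n - m) hu hui hu0).1 (h1 ▸ hu')
    omega
  choose! u v hu hui hx using hfac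
  have hu0 : ∀ x, x ≠ 0 → u x ≠ 0 := fun x hx0 h => hx0 (by rw [hx x hx0, h, zero_mul])
  have v_eq : ∀ (x : K), x ≠ 0 → ∀ (w : K) (n : ℤ), w ∈ V → w⁻¹ ∈ V → x = w * π ^ n →
      v x = n := by
    intro x hx0 w n hw hwi h
    have hw0 : w ≠ 0 := fun h' => hx0 (by rw [h, h', zero_mul])
    have h2 : u x * π ^ v x = w * π ^ n := by rw [← hx x hx0, ← h]
    exact le_antisymm (exponent_le _ _ _ _ hw hwi hw0 (hu x hx0) h2.symm)
      (exponent_le _ _ _ _ (hu x hx0) (hui x hx0) (hu0 x hx0) hw h2)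
  refine ⟨π, v, hπ0, ?_, ?_, ?_⟩
  · exact v_eq π hπ0 1 1 V.one_mem (by simp [V.one_mem]) (by simp)
  · intro x y hx0 hy0
    refine v_eq _ (mul_ne_zero hx0 hy0) (u x * u y) _ (V.mul_mem (hu x hx0) (hu y hy0)) ?_ ?_
    · rw [mul_inv]
      exact V.mul_mem (hui x hx0) (hui y hy0)
    · conv_lhs => rw [hx x hx0, hx y hy0]
      rw [zpow_add₀ hπ0]
      ring
  · intro x hx0
    conv_lhs => rw [hx x hx0]
    exact mem_iff _ _ (hu x hx0) (hui x hx0) (hu0 x hx0)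

/-- The valuations defining a Krull domain, restricted to the nonzero elements of the domain,
together with their centers. -/
theorem IsKrullDomain.exists_valuations {R : Type} [CommRing R] [IsDomain R]
    (hR : IsKrullDomain R) :
    ∃ (ι : Type) (w : ι → R → ℕ) (p : ι → Ideal R), (∀ i, (p i).IsPrime) ∧
      (∀ i x y, x ≠ 0 → y ≠ 0 → w i (x * y) = w i x + w i y) ∧
      (∀ i x, x ≠ 0 → (x ∈ p i ↔ w i x ≠ 0)) ∧
      (∀ x y, x ≠ 0 → y ≠ 0 → (∀ i, w i x ≤ w i y) → x ∣ y) ∧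
      ∀ x, x ≠ 0 → {i | x ∈ p i}.Finite := by
  obtain ⟨ι, V, hV, hint, hfin⟩ := hR
  choose π v hπ0 hvπ hmul hmem using fun i => (hV i).exists_valuation
  let f := algebraMap R (FractionRing R)
  have hf0 : ∀ {x}, x ≠ 0 → f x ≠ 0 := fun {x} hx =>
    (map_ne_zero_iff f (IsFractionRing.injective R (FractionRing R))).2 hx
  have mem_V : ∀ i x, f x ∈ V i := fun i x => by
    have : f x ∈ ⋂ i, (V i : Set (FractionRing R)) := hint ▸ ⟨x, rfl⟩
    exact Set.mem_iInter.1 this i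
  have v_nonneg : ∀ i x, x ≠ 0 → 0 ≤ v i (f x) := fun i x hx =>
    (hmem i _ (hf0 hx)).1 (mem_V i x)
  have v_div : ∀ i x y, x ≠ 0 → y ≠ 0 → v i (x / y) = v i x - v i y := by
    intro i x y hx hy
    have := hmul i (x / y) y (div_ne_zero hx hy) hy
    rw [div_mul_cancel₀ _ hy] at this
    omega
  let p : ι → Ideal R := fun i =>
    { carrier := {x | f x / π i ∈ V i}
      add_mem' := fun {a b} ha hb => by
        simpa only [Set.mem_ofPred_eq, map_add, add_div] using (V i).add_mem ha hb
      zero_mem' := by simp [(V i).zero_mem]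
      smul_mem' := fun c x hx => by
        simpa only [Set.mem_ofPred_eq, smul_eq_mul, map_mul, mul_div_assoc] using
          (V i).mul_mem (mem_V i c) hx }
  have mem_p : ∀ i x, x ≠ 0 → (x ∈ p i ↔ 1 ≤ v i (f x)) := by
    intro i x hx
    change f x / π i ∈ V i ↔ _
    rw [hmem i _ (div_ne_zero (hf0 hx) (hπ0 i)), v_div i _ _ (hf0 hx) (hπ0 i), hvπ]
    omega
  have v_one : ∀ i, v i 1 = 0 := fun i => by
    simpa using v_div i 1 1 one_ne_zero one_ne_zero
  refine ⟨ι, fun i x => (v i (f x)).toNat, p, fun i => ⟨?_, ?_⟩, ?_, ?_, ?_, ?_⟩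
  · rw [Ideal.ne_top_iff_one, mem_p i 1 one_ne_zero, map_one, v_one]
    omega
  · intro x y hxy
    by_cases hx : x = 0
    · exact .inl (hx ▸ (p i).zero_mem)
    by_cases hy : y = 0
    · exact .inr (hy ▸ (p i).zero_mem)
    rw [mem_p i _ (mul_ne_zero hx hy), map_mul, hmul i _ _ (hf0 hx) (hf0 hy)] at hxy
    rw [mem_p i _ hx, mem_p i _ hy]
    omega
  · intro i x y hx hy
    have := v_nonneg i x hx
    have := v_nonneg i y hy
    simp only [map_mul, hmul i _ _ (hf0 hx) (hf0 hy)]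
    omega
  · intro i x hx
    rw [mem_p i x hx]
    dsimp only
    omega
  · intro x y hx hy h
    have : f y / f x ∈ ⋂ i, (V i : Set (FractionRing R)) := by
      refine Set.mem_iInter.2 fun i => ?_
      refine (hmem i _ (div_ne_zero (hf0 hy) (hf0 hx))).2 ?_
      rw [v_div i _ _ (hf0 hy) (hf0 hx)]
      have : (v i (f x)).toNat ≤ (v i (f y)).toNat := h i
      have := v_nonneg i x hx
      have := v_nonneg i y hy
      omega
    rw [← hint] at this
    obtain ⟨z, hz⟩ := this
    refine ⟨z, IsFractionRing.injective R (FractionRing R) ?_⟩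
    rw [map_mul, hz]
    exact (mul_div_cancel₀ _ (hf0 hx)).symm
  · intro x hx
    refine (hfin _ (hf0 hx)).subset fun i hi hunit => ?_
    have h1 := (mem_p i x hx).1 hi
    have h2 := (hmem i _ (inv_ne_zero (hf0 hx))).1 hunit.2
    rw [← one_div, v_div i _ _ one_ne_zero (hf0 hx), v_one] at h2
    omega

section Graded

variable {s : ℕ} {R : Type} [CommRing R] (𝒜 : (Fin s → ℤ) → AddSubgroup R) [GradedRing 𝒜]

/-- The homogeneous core of a prime ideal of a `ℤ^s`-graded ring is prime. -/
theorem Ideal.IsPrime.homogeneousCore_pi_int {I : Ideal R} (hI : I.IsPrime) :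
    (I.homogeneousCore 𝒜).toIdeal.IsPrime := by
  let ℬ : Lex (Fin s → ℤ) → AddSubgroup R := fun i => 𝒜 (ofLex i)
  refine @Ideal.IsPrime.homogeneousCore (Lex (Fin s → ℤ)) _ R _ _ _ _ _ _ ℬ ?_ I hI
  convert (inferInstance : GradedRing 𝒜)
  all_goals rfl

/-- If `a` and `a * r` are homogeneous and `a` is nonzero, then `r` is homogeneous. -/
theorem SetLike.IsHomogeneousElem.of_mul_left [IsDomain R] {a r : R}
    (ha : SetLike.IsHomogeneousElem 𝒜 a) (ha0 : a ≠ 0)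
    (har : SetLike.IsHomogeneousElem 𝒜 (a * r)) : SetLike.IsHomogeneousElem 𝒜 r := by
  obtain ⟨i, hi⟩ := ha
  obtain ⟨j, hj⟩ := har
  have h := DirectSum.coe_decompose_mul_add_of_left_mem 𝒜 (b := r) (j := j - i) hi
  rw [add_sub_cancel, DirectSum.decompose_of_mem_same 𝒜 hj] at h
  exact ⟨j - i, mul_left_cancel₀ ha0 h ▸ SetLike.coe_mem _⟩

variable {𝒜}

/-- A homogeneous element outside the unique graded maximal ideal is a unit. -/
theorem IsUniqueGradedMaximal.isUnit [IsDomain R] {P : Ideal R} (hP : IsUniqueGradedMaximal 𝒜 P)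
    {x : R} (hx : SetLike.IsHomogeneousElem 𝒜 x) (hxP : x ∉ P) : IsUnit x := by
  rw [← Ideal.span_singleton_eq_top]
  by_contra h
  refine hxP (hP.2.2 _ (Ideal.homogeneous_span 𝒜 {x} ?_) h (Ideal.mem_span_singleton_self x))
  rintro _ rfl
  exact hx

/-- If the graded maximal ideal has height one, it lies in every prime ideal containing a nonzero
homogeneous element. -/
theorem IsUniqueGradedMaximal.le_of_mem [IsDomain R] {P : Ideal R}
    (hP : IsUniqueGradedMaximal 𝒜 P) (hht : IdealHeightOne R P) {p : Ideal R} (hp : p.IsPrime)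
    {x : R} (hx : SetLike.IsHomogeneousElem 𝒜 x) (hx0 : x ≠ 0) (hxp : x ∈ p) : P ≤ p := by
  obtain ⟨-, Q, hQ, hPQ, hQht⟩ := hht
  set c := (p.homogeneousCore 𝒜).toIdeal with hc
  have hcp : c ≤ p := Ideal.toIdeal_homogeneousCore_le 𝒜 p
  have hcprime : c.IsPrime := hp.homogeneousCore_pi_int 𝒜
  have hcP : c ≤ P := hP.2.2 c (p.homogeneousCore 𝒜).isHomogeneous hcprime.ne_top
  have hxc : x ∈ c := Ideal.mem_homogeneousCore_of_homogeneous_of_mem hx hxp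
  suffices c = Q from hPQ.trans (this ▸ hcp)
  by_contra hne
  have hbot : (⊥ : PrimeSpectrum R) < ⟨c, hcprime⟩ := by
    refine bot_lt_iff_ne_bot.2 fun h => hx0 ?_
    have h' : c = ⊥ := congrArg PrimeSpectrum.asIdeal h
    simpa [h'] using hxc
  have hlt : (⟨c, hcprime⟩ : PrimeSpectrum R) < ⟨Q, hQ⟩ :=
    lt_of_le_of_ne (hcP.trans hPQ) fun h => hne (congrArg PrimeSpectrum.asIdeal h)
  exact (Order.one_lt_height_iff.2 ⟨_, _, hbot, hlt⟩).ne' hQht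

end Graded

/-- **The graded maximal ideal of a homogeneous DVR is principal.**
Let `R = ⊕_{λ ∈ ℤ^s} R_λ` be a `ℤ^s`-graded Krull domain with a unique graded
maximal ideal `P` of height one (a "homogeneous DVR").  Then `P` is a
principal ideal. -/
theorem homogeneous_dvr_graded_maximal_isPrincipal
    {s : ℕ} {R : Type} [CommRing R] [IsDomain R]
    (𝒜 : (Fin s → ℤ) → AddSubgroup R) [GradedRing 𝒜]
    (hKrull : IsKrullDomain R)
    (P : Ideal R) (hmax : IsUniqueGradedMaximal 𝒜 P)
    (hht : IdealHeightOne R P) :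
    P.IsPrincipal := by
  obtain ⟨ι, w, p, hp, hmul, hmem, hdvd, hfin⟩ := hKrull.exists_valuations
  by_cases hPbot : P = ⊥
  · exact hPbot ▸ inferInstance
  let H : Set R := {x | SetLike.IsHomogeneousElem 𝒜 x ∧ x ≠ 0 ∧ x ∈ P}
  obtain ⟨a₀, ha₀⟩ : H.Nonempty := by
    obtain ⟨x, hxP, hx0⟩ := Submodule.exists_mem_ne_zero_of_ne_bot hPbot
    by_contra! h
    refine hx0 ((DirectSum.decompose 𝒜).injective (DFinsupp.ext fun i => Subtype.ext ?_))
    by_contra h0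
    rw [DirectSum.decompose_zero] at h0
    exact h.subset ⟨⟨i, SetLike.coe_mem _⟩, h0, hmax.1 i hxP⟩
  have w_pow : ∀ i x k, x ≠ 0 → w i (x ^ k) = k * w i x := by
    intro i x k hx
    induction k with
    | zero => simpa using hmul i 1 1 one_ne_zero one_ne_zero
    | succ k ih => rw [pow_succ, hmul i _ _ (pow_ne_zero k hx) hx, ih, add_mul, one_mul]
  have hle : ∀ i x, x ∈ H → x ∈ p i → P ≤ p i := fun i x hx hxi =>
    hmax.le_of_mem hht (hp i) hx.1 hx.2.1 hxi
  have exists_center : ∀ x ∈ H, ∃ i, x ∈ p i := by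
    intro x hx
    by_contra! h
    have h1 : x ∣ 1 := hdvd x 1 hx.2.1 one_ne_zero fun i => by
      have := (hmem i x hx.2.1).not.1 (h i)
      omega
    exact hmax.2.1 (P.eq_top_of_isUnit_mem hx.2.2 (isUnit_of_dvd_one h1))
  -- All the valuations are proportional on homogeneous elements.
  have proportional : ∀ a ∈ H, ∀ b ∈ H, ∃ n m : ℕ, n ≠ 0 ∧ ∀ j, n * w j b = m * w j a := by
    intro a ha b hb
    obtain ⟨i, hi, hmin⟩ := Set.exists_min_image {i | a ∈ p i}
      (fun i => (w i b : ℚ) / w i a) (hfin a ha.2.1) (exists_center a ha)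
    have hia : w i a ≠ 0 := (hmem i a ha.2.1).1 hi
    have hab : ∀ j, w i b * w j a ≤ w i a * w j b := by
      intro j
      by_cases hj : a ∈ p j
      · have hja : w j a ≠ 0 := (hmem j a ha.2.1).1 hj
        have h := hmin j hj
        rw [div_le_div_iff₀ (by positivity) (by positivity)] at h
        rw [mul_comm (w i a)]
        exact_mod_cast h
      · have hja : w j a = 0 := not_not.1 ((hmem j a ha.2.1).not.1 hj)
        simp [hja]
    have ha0 := pow_ne_zero (w i b) ha.2.1
    have hb0 := pow_ne_zero (w i a) hb.2.1
    obtain ⟨r, hr⟩ := hdvd (a ^ w i b) (b ^ w i a) ha0 hb0 fun j => by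
      rw [w_pow j a _ ha.2.1, w_pow j b _ hb.2.1]
      exact hab j
    have hr0 : r ≠ 0 := by
      rintro rfl
      exact hb0 (by rw [hr, mul_zero])
    have hwr : ∀ j, w i a * w j b = w i b * w j a + w j r := fun j => by
      rw [← w_pow j b _ hb.2.1, hr, hmul j _ _ ha0 hr0, w_pow j a _ ha.2.1]
    have pow_hom : ∀ x k, SetLike.IsHomogeneousElem 𝒜 x → SetLike.IsHomogeneousElem 𝒜 (x ^ k) :=
      fun x k hx => (SetLike.homogeneousSubmonoid 𝒜).pow_mem hx k
    have hrhom : SetLike.IsHomogeneousElem 𝒜 r :=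
      (pow_hom a _ ha.1).of_mul_left 𝒜 ha0 (hr ▸ pow_hom b _ hb.1)
    have hri : r ∉ p i := fun h => (hmem i r hr0).1 h <| by
      have := hwr i
      rwa [mul_comm, left_eq_add] at this
    have hrunit : IsUnit r := hmax.isUnit hrhom fun h => hri (hle i a ha hi h)
    refine ⟨w i a, w i b, hia, fun j => ?_⟩
    have hrj : w j r = 0 := not_not.1 <|
      (hmem j r hr0).not.1 fun h => (hp j).ne_top ((p j).eq_top_of_isUnit_mem h hrunit)
    rw [hwr j, hrj, add_zero]
  obtain ⟨i, hi⟩ := exists_center a₀ ha₀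
  obtain ⟨a, ha, hmin⟩ : ∃ a ∈ H, ∀ b ∈ H, w i a ≤ w i b := by
    obtain ⟨a, ha, h⟩ := (measure (w i)).wf.has_min H ⟨a₀, ha₀⟩
    exact ⟨a, ha, fun b hb => not_lt.1 (h b hb)⟩
  have hia : w i a ≠ 0 := (hmem i a ha.2.1).1 (hle i a₀ ha₀ hi ha.2.2)
  have a_dvd : ∀ b ∈ H, a ∣ b := by
    intro b hb
    obtain ⟨n, m, hn, h⟩ := proportional a ha b hb
    have hnm : n ≤ m := Nat.le_of_mul_le_mul_right
      ((Nat.mul_le_mul_left n (hmin b hb)).trans_eq (h i)) (Nat.pos_of_ne_zero hia)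
    exact hdvd a b ha.2.1 hb.2.1 fun j => Nat.le_of_mul_le_mul_left
      ((Nat.mul_le_mul_right _ hnm).trans_eq (h j).symm) (Nat.pos_of_ne_zero hn)
  refine ⟨⟨a, le_antisymm (fun x hx => ?_) ((Ideal.span_singleton_le_iff_mem P).2 ha.2.2)⟩⟩
  classical
  rw [← DirectSum.sum_support_decompose 𝒜 x]
  refine Submodule.sum_mem _ fun j hj => Ideal.mem_span_singleton.2 (a_dvd _ ?_)
  exact ⟨⟨j, SetLike.coe_mem _⟩, by simpa using hj, hmax.1 j hx⟩
end

section
/- Let A → B be a homomorphism of Noetherian rings whose fibers are zero-dimensional (e.g., an integral homomorphism), and M a B-module. Then for every prime p of A, depth_{A_p} M_p = inf over primes P of B lying over p of depth_{B_P} M_P. If moreover the going-down theorem holds between A and B and M satisfies (S'_n) as a B-module, then M satisfies (S'_n) as an A-module. -/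
open CategoryTheory

section CocycleRepresentatives

open Opposite

variable {R : Type} [CommRing R]

/-- The element `f` of the `n`-th term represents the homology class `x`, for a chain complex in the
opposite of the category of modules. -/
def RepresentsClass (K : ChainComplex (ModuleCat.{0} R)ᵒᵖ ℕ) (n : ℕ)
    (f : (K.X n).unop) (x : (K.homology n).unop) : Prop :=
  ∃ z : (K.opcycles n).unop, (K.pOpcycles n).unop.hom z = f ∧ (K.homologyι n).unop.hom z = x

lemma exists_representsClass (K : ChainComplex (ModuleCat.{0} R)ᵒᵖ ℕ) (n : ℕ)
    (x : (K.homology n).unop) :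
    ∃ f, (K.d (n + 1) n).unop.hom f = 0 ∧ RepresentsClass K n f x := by
  have hepi : Epi (K.homologyι n).unop := inferInstance
  obtain ⟨z, rfl⟩ := (ModuleCat.epi_iff_surjective _).1 hepi x
  refine ⟨_, ?_, z, rfl, rfl⟩
  have h := congrArg Quiver.Hom.unop (K.d_pOpcycles (n + 1) n)
  exact congrArg (fun q => q.hom z) h

lemma representsClass_of_cocycle (K : ChainComplex (ModuleCat.{0} R)ᵒᵖ ℕ) (n : ℕ)
    (f : (K.X n).unop) (hf : (K.d (n + 1) n).unop.hom f = 0) :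
    ∃ x, RepresentsClass K n f x := by
  let S : ShortComplex (ModuleCat.{0} R)ᵒᵖ := ShortComplex.mk _ _ (K.d_pOpcycles (n + 1) n)
  have hS : S.Exact := ShortComplex.exact_of_g_is_cokernel _
    (K.opcyclesIsCokernel (n + 1) n (by simp))
  have := (ShortComplex.moduleCat_exact_iff _).1 hS.unop f hf
  obtain ⟨z, hz⟩ := this
  exact ⟨_, z, hz, rfl⟩

lemma RepresentsClass.eq_zero_iff {K : ChainComplex (ModuleCat.{0} R)ᵒᵖ ℕ} {n : ℕ}
    {f : (K.X n).unop} {x : (K.homology n).unop} (h : RepresentsClass K n f x) :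
    x = 0 ↔ ∃ g : (K.X ((ComplexShape.down ℕ).next n)).unop,
      (K.d n ((ComplexShape.down ℕ).next n)).unop.hom g = f := by
  obtain ⟨z, rfl, rfl⟩ := h
  let S : ShortComplex (ModuleCat.{0} R)ᵒᵖ :=
    ShortComplex.mk _ _ (K.homologyι_comp_fromOpcycles n ((ComplexShape.down ℕ).next n))
  have hS : S.Exact := ShortComplex.exact_of_f_is_kernel _
    (K.homologyIsKernel n _ rfl)
  have hmono : Mono (K.pOpcycles n).unop := inferInstance
  have hd := congrArg Quiver.Hom.unop (K.p_fromOpcycles n ((ComplexShape.down ℕ).next n))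
  constructor
  · intro hz
    obtain ⟨g, hg⟩ := (ShortComplex.moduleCat_exact_iff _).1 hS.unop z hz
    refine ⟨g, ?_⟩
    rw [← hd, ← hg]
    rfl
  · rintro ⟨g, hg⟩
    have hz : (K.fromOpcycles n ((ComplexShape.down ℕ).next n)).unop.hom g = z := by
      apply (ModuleCat.mono_iff_injective _).1 hmono
      rw [← hd] at hg
      exact hg
    rw [← hz]
    have h := congrArg Quiver.Hom.unop
      (K.homologyι_comp_fromOpcycles n ((ComplexShape.down ℕ).next n))
    exact congrArg (fun q => q.hom g) h

lemma RepresentsClass.map {K L : ChainComplex (ModuleCat.{0} R)ᵒᵖ ℕ} (φ : K ⟶ L) {n : ℕ}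
    {f : (L.X n).unop} {x : (L.homology n).unop} (h : RepresentsClass L n f x) :
    RepresentsClass K n ((φ.f n).unop.hom f)
      ((HomologicalComplex.homologyMap φ n).unop.hom x) := by
  obtain ⟨z, rfl, rfl⟩ := h
  refine ⟨(HomologicalComplex.opcyclesMap φ n).unop.hom z, ?_, ?_⟩
  · have h := congrArg Quiver.Hom.unop (HomologicalComplex.p_opcyclesMap φ n)
    exact congrArg (fun q => q.hom z) h
  · have h := congrArg Quiver.Hom.unop (HomologicalComplex.homologyι_naturality φ n)
    exact (congrArg (fun q => q.hom z) h).symm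

/-- The cocycle `f` on a projective resolution represents the element `x` of `Ext`. -/
def RepresentsExt {X : ModuleCat.{0} R} (P : ProjectiveResolution X) (n : ℕ)
    {Y : ModuleCat.{0} R} (f : P.complex.X n ⟶ Y)
    (x : ((Ext R (ModuleCat.{0} R) n).obj (op X)).obj Y) : Prop :=
  RepresentsClass ((((linearYoneda R (ModuleCat.{0} R)).obj Y).rightOp.mapHomologicalComplex
    (ComplexShape.down ℕ)).obj P.complex) n f
    ((P.isoLeftDerivedObj ((linearYoneda R (ModuleCat.{0} R)).obj Y).rightOp n).inv.unop.hom x)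

lemma exists_representsExt {X : ModuleCat.{0} R} (P : ProjectiveResolution X) (n : ℕ)
    {Y : ModuleCat.{0} R} (x : ((Ext R (ModuleCat.{0} R) n).obj (op X)).obj Y) :
    ∃ f : P.complex.X n ⟶ Y, P.complex.d (n + 1) n ≫ f = 0 ∧ RepresentsExt P n f x :=
  exists_representsClass ((((linearYoneda R (ModuleCat.{0} R)).obj Y).rightOp.mapHomologicalComplex
    (ComplexShape.down ℕ)).obj P.complex) n
    ((P.isoLeftDerivedObj ((linearYoneda R (ModuleCat.{0} R)).obj Y).rightOp n).inv.unop.hom x)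

lemma representsExt_of_cocycle {X : ModuleCat.{0} R} (P : ProjectiveResolution X) (n : ℕ)
    {Y : ModuleCat.{0} R} (f : P.complex.X n ⟶ Y) (hf : P.complex.d (n + 1) n ≫ f = 0) :
    ∃ x, RepresentsExt P n f x := by
  let F := ((linearYoneda R (ModuleCat.{0} R)).obj Y).rightOp
  obtain ⟨y, hy⟩ := representsClass_of_cocycle
    ((F.mapHomologicalComplex (ComplexShape.down ℕ)).obj P.complex) n f hf
  refine ⟨(P.isoLeftDerivedObj F n).hom.unop.hom y, ?_⟩
  have h := congrArg Quiver.Hom.unop (P.isoLeftDerivedObj F n).inv_hom_id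
  have h' : (P.isoLeftDerivedObj F n).inv.unop.hom ((P.isoLeftDerivedObj F n).hom.unop.hom y) = y :=
    congrArg (fun q => q.hom y) h
  unfold RepresentsExt
  rw [h']
  exact hy

lemma RepresentsExt.eq_zero_iff {X : ModuleCat.{0} R} {P : ProjectiveResolution X} {n : ℕ}
    {Y : ModuleCat.{0} R} {f : P.complex.X n ⟶ Y}
    {x : ((Ext R (ModuleCat.{0} R) n).obj (op X)).obj Y} (h : RepresentsExt P n f x) :
    x = 0 ↔ ∃ g : P.complex.X ((ComplexShape.down ℕ).next n) ⟶ Y,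
      P.complex.d n ((ComplexShape.down ℕ).next n) ≫ g = f := by
  let F := ((linearYoneda R (ModuleCat.{0} R)).obj Y).rightOp
  refine Iff.trans ?_ (RepresentsClass.eq_zero_iff h)
  constructor
  · rintro rfl
    exact map_zero _
  · intro h0
    have h1 := congrArg Quiver.Hom.unop (P.isoLeftDerivedObj F n).hom_inv_id
    have h2 : (P.isoLeftDerivedObj F n).hom.unop.hom
      ((P.isoLeftDerivedObj F n).inv.unop.hom x) = x := congrArg (fun q => q.hom x) h1
    rw [← h2]
    exact (congrArg _ h0).trans (map_zero _)

lemma RepresentsExt.map {X X' : ModuleCat.{0} R} {P : ProjectiveResolution X}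
    (P' : ProjectiveResolution X') (g : X' ⟶ X) {n : ℕ} {Y : ModuleCat.{0} R}
    {f : P.complex.X n ⟶ Y} {x : ((Ext R (ModuleCat.{0} R) n).obj (op X)).obj Y}
    (h : RepresentsExt P n f x) :
    RepresentsExt P' n ((ProjectiveResolution.lift g P' P).f n ≫ f)
      (((Ext R (ModuleCat.{0} R) n).map g.op).app Y x) := by
  let F := ((linearYoneda R (ModuleCat.{0} R)).obj Y).rightOp
  have h1 := RepresentsClass.map
    ((F.mapHomologicalComplex (ComplexShape.down ℕ)).map (ProjectiveResolution.lift g P' P)) h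
  have h2 := ProjectiveResolution.isoLeftDerivedObj_inv_naturality g P' P
    (ProjectiveResolution.lift g P' P) (ProjectiveResolution.lift_commutes_zero ..) F n
  have h3 : (P'.isoLeftDerivedObj F n).inv.unop.hom
      (((Ext R (ModuleCat.{0} R) n).map g.op).app Y x) =
      (HomologicalComplex.homologyMap ((F.mapHomologicalComplex (ComplexShape.down ℕ)).map
        (ProjectiveResolution.lift g P' P)) n).unop.hom
        ((P.isoLeftDerivedObj F n).inv.unop.hom x) := congrArg (fun q => q.unop.hom x) h2
  exact (congrArg (RepresentsClass _ n _) h3).mpr h1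

end CocycleRepresentatives

section LocalCohomologyCocycles

open Opposite Limits

variable {R : Type} [CommRing R]

/-- The quotient `R ⧸ I ^ t`, as a term of the system computing local cohomology. -/
abbrev powQuotient (I : Ideal R) (t : ℕ) : ModuleCat.{0} R :=
  (localCohomology.ringModIdeals (localCohomology.idealPowersDiagram I)).obj (op t)

/-- The projection `R ⧸ I ^ s ⟶ R ⧸ I ^ t` for `t ≤ s`. -/
abbrev powQuotientMap (I : Ideal R) {s t : ℕ} (h : t ≤ s) :
    powQuotient I s ⟶ powQuotient I t :=
  (localCohomology.ringModIdeals (localCohomology.idealPowersDiagram I)).map (homOfLE h).op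

/-- The transition map between the chosen projective resolutions of the powers quotients. -/
noncomputable abbrev powResolutionMap (I : Ideal R) {s t : ℕ} (h : t ≤ s) :
    (projectiveResolution (powQuotient I s)).complex ⟶
      (projectiveResolution (powQuotient I t)).complex :=
  ProjectiveResolution.lift (powQuotientMap I h) _ _

/-- A degree `n` cochain on a projective resolution is a coboundary. -/
def IsCoboundary {X Y : ModuleCat.{0} R} (P : ProjectiveResolution X) {n : ℕ}
    (f : P.complex.X n ⟶ Y) : Prop :=
  ∃ g : P.complex.X ((ComplexShape.down ℕ).next n) ⟶ Y,
    P.complex.d n ((ComplexShape.down ℕ).next n) ≫ g = f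

theorem subsingleton_localCohomology_iff (I : Ideal R) (n : ℕ) (M : ModuleCat.{0} R) :
    Subsingleton ((localCohomology I n).obj M) ↔
      ∀ (t : ℕ) (f : (projectiveResolution (powQuotient I t)).complex.X n ⟶ M),
        (projectiveResolution (powQuotient I t)).complex.d (n + 1) n ≫ f = 0 →
        ∃ (s : ℕ) (h : t ≤ s),
          IsCoboundary (projectiveResolution (powQuotient I s))
            ((powResolutionMap I h).f n ≫ f) := by
  let G := localCohomology.diagram (localCohomology.idealPowersDiagram I) n
  let F := G ⋙ (evaluation (ModuleCat.{0} R) (ModuleCat.{0} R)).obj M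
  let e : (localCohomology I n).obj M ≅ colimit F := colimitObjIsoColimitCompEvaluation G M
  have he : Subsingleton ((localCohomology I n).obj M) ↔ Subsingleton (colimit F :) :=
    e.toLinearEquiv.toEquiv.subsingleton_congr
  rw [he]
  constructor
  · intro hs t f hf
    obtain ⟨x, hx⟩ := representsExt_of_cocycle _ n f hf
    have h0 : (ConcreteCategory.hom (colimit.ι F (op (op t)))) x = 0 := Subsingleton.elim _ _
    obtain ⟨j, i, hi⟩ := Concrete.colimit_rep_eq_zero R F _ x h0
    obtain ⟨⟨s⟩⟩ := j
    have hts : t ≤ s := leOfHom i.unop.unop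
    refine ⟨s, hts, ?_⟩
    refine (RepresentsExt.map (projectiveResolution (powQuotient I s))
      (powQuotientMap I hts) hx).eq_zero_iff.1 ?_
    exact hi
  · intro h
    refine subsingleton_of_forall_eq 0 fun y => ?_
    obtain ⟨⟨⟨t⟩⟩, x, rfl⟩ := Concrete.colimit_exists_rep F y
    obtain ⟨f, hf, hx⟩ := exists_representsExt (projectiveResolution (powQuotient I t)) n x
    obtain ⟨s, hts, hb⟩ := h t f hf
    have h1 := (RepresentsExt.map (projectiveResolution (powQuotient I s))
      (powQuotientMap I hts) hx).eq_zero_iff.2 hb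
    have h2 : F.map (homOfLE hts).op.op x = 0 := h1
    have h3 := ConcreteCategory.congr_hom (colimit.w F (homOfLE hts).op.op) x
    rw [← h3, ConcreteCategory.comp_apply, h2, map_zero]

end LocalCohomologyCocycles

section SmulCoboundary

variable {R : Type} [CommRing R]

lemma smul_powQuotient (I : Ideal R) {t : ℕ} {a : R} (ha : a ∈ I ^ t) (x : powQuotient I t) :
    a • x = 0 := by
  obtain ⟨y, rfl⟩ := Ideal.Quotient.mk_surjective (I := I ^ t) x
  have : Ideal.Quotient.mk (I ^ t) (a * y) = 0 :=
    Ideal.Quotient.eq_zero_iff_mem.2 (Ideal.mul_mem_right _ _ ha)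
  exact this

lemma isCoboundary_smul (I : Ideal R) {t n : ℕ} (P : ProjectiveResolution (powQuotient I t))
    {Y : ModuleCat.{0} R} (f : P.complex.X n ⟶ Y) (hf : P.complex.d (n + 1) n ≫ f = 0)
    {a : R} (ha : a ∈ I ^ t) : IsCoboundary P (a • f) := by
  have hπ : (a • 𝟙 P.complex) ≫ P.π = 0 := by
    rw [Linear.smul_comp, Category.id_comp]
    apply HomologicalComplex.to_single_hom_ext
    ext x
    exact smul_powQuotient I ha ((P.π.f 0).hom x)
  have H := ProjectiveResolution.liftHomotopyZero (a • 𝟙 P.complex) hπ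
  refine ⟨H.hom ((ComplexShape.down ℕ).next n) n ≫ f, ?_⟩
  have h := H.comm n
  have h1 : prevD n H.hom = H.hom n (n + 1) ≫ P.complex.d (n + 1) n :=
    prevD_eq _ (by simp)
  rw [h1] at h
  have h2 := congrArg (fun q => q ≫ f) h
  simpa [dNext, hf] using h2.symm

lemma IsCoboundary.of_smul_end_eq_top {I : Ideal R} {E : ModuleCat.{0} R}
    (hE : I • (⊤ : Submodule R (E ⟶ E)) = ⊤) {t n : ℕ}
    (P : ProjectiveResolution (powQuotient I t))
    (f : P.complex.X n ⟶ E) (hf : P.complex.d (n + 1) n ≫ f = 0) : IsCoboundary P f := by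
  have hpow : ∀ t, I ^ t • (⊤ : Submodule R (E ⟶ E)) = ⊤ := by
    intro t
    induction t with
    | zero => simp
    | succ k ih => rw [pow_succ, Submodule.mul_smul, hE, ih]
  suffices h : ∀ u ∈ I ^ t • (⊤ : Submodule R (E ⟶ E)), IsCoboundary P (f ≫ u) by
    simpa using h (𝟙 E) ((hpow t).symm ▸ Submodule.mem_top)
  intro u hu
  induction hu using Submodule.smul_induction_on' with
  | smul a ha u _ =>
    rw [Linear.comp_smul]
    exact isCoboundary_smul I P _ (by rw [← Category.assoc, hf, Limits.zero_comp]) ha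
  | add u _ v _ hu hv =>
    obtain ⟨g, hg⟩ := hu
    obtain ⟨g', hg'⟩ := hv
    exact ⟨g + g', by rw [Preadditive.comp_add, Preadditive.comp_add, hg, hg']⟩

lemma eq_zero_of_smul_end_eq_top {I : Ideal R} {E : Type} [AddCommGroup E] [Module R E]
    (hE : I • (⊤ : Submodule R (Module.End R E)) = ⊤) (z : E) (hz : ∀ a ∈ I, a • z = 0) : z = 0 := by
  suffices h : ∀ u ∈ I • (⊤ : Submodule R (Module.End R E)), u z = 0 from
    h 1 (hE.symm ▸ Submodule.mem_top)
  intro u hu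
  induction hu using Submodule.smul_induction_on' with
  | smul a ha u _ => rw [LinearMap.smul_apply, ← map_smul, hz a ha, map_zero]
  | add u _ v _ hu hv => rw [LinearMap.add_apply, hu, hv, add_zero]

end SmulCoboundary

section DimensionShift

open Limits

variable {R : Type} [CommRing R]

lemma isCoboundary_succ_iff {X Y : ModuleCat.{0} R} (P : ProjectiveResolution X) {n : ℕ}
    (f : P.complex.X (n + 1) ⟶ Y) :
    IsCoboundary P f ↔ ∃ g : P.complex.X n ⟶ Y, P.complex.d (n + 1) n ≫ g = f := by
  unfold IsCoboundary
  rw [(ComplexShape.down ℕ).next_eq' (by simp : (ComplexShape.down ℕ).Rel (n + 1) n)]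

lemma exists_comp_eq_of_comp_eq_zero {X M E Q : ModuleCat.{0} R} {ι : M ⟶ E} {π : E ⟶ Q}
    (hex : Function.Exact ι π) (hι : Function.Injective ι) (f : X ⟶ E) (hf : f ≫ π = 0) :
    ∃ k : X ⟶ M, k ≫ ι = f := by
  have hrange : ∀ x, f.hom x ∈ LinearMap.range ι.hom := fun x =>
    (hex _).1 (congrArg (fun q => q.hom x) hf)
  let e := LinearEquiv.ofInjective ι.hom hι
  refine ⟨ModuleCat.ofHom (e.symm.toLinearMap ∘ₗ f.hom.codRestrict _ hrange), ?_⟩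
  ext x
  exact congrArg Subtype.val (e.apply_symm_apply (f.hom.codRestrict _ hrange x))

lemma subsingleton_localCohomology_succ_iff (I : Ideal R) (n : ℕ) {M E Q : ModuleCat.{0} R}
    {ι : M ⟶ E} {π : E ⟶ Q} (hex : Function.Exact ι π) (hι : Function.Injective ι)
    (hπ : Function.Surjective π) (hE : I • (⊤ : Submodule R (E ⟶ E)) = ⊤) :
    Subsingleton ((localCohomology I (n + 1)).obj M) ↔
      Subsingleton ((localCohomology I n).obj Q) := by
  have hmono : Mono ι := (ModuleCat.mono_iff_injective _).2 hι
  have hepi : Epi π := (ModuleCat.epi_iff_surjective _).2 hπ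
  have hzero : ι ≫ π = 0 := by
    ext x
    exact hex.apply_apply_eq_zero x
  have hproj (t i : ℕ) : Projective ((projectiveResolution (powQuotient I t)).complex.X i) :=
    (projectiveResolution (powQuotient I t)).projective i
  rw [subsingleton_localCohomology_iff, subsingleton_localCohomology_iff]
  constructor
  · intro H t f hf
    obtain ⟨k, hk⟩ := exists_comp_eq_of_comp_eq_zero hex hι
      ((projectiveResolution (powQuotient I t)).complex.d (n + 1) n ≫ Projective.factorThru f π)
      (by rw [Category.assoc, Projective.factorThru_comp, hf])
    obtain ⟨s, hts, hb⟩ := H t k (by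
      rw [← cancel_mono ι, Category.assoc, hk, HomologicalComplex.d_comp_d_assoc]
      simp)
    obtain ⟨g, hg⟩ := (isCoboundary_succ_iff _ _).1 hb
    obtain ⟨h, hh⟩ := IsCoboundary.of_smul_end_eq_top hE
      (projectiveResolution (powQuotient I s))
      ((powResolutionMap I hts).f n ≫ Projective.factorThru f π - g ≫ ι) (by
        rw [Preadditive.comp_sub, sub_eq_zero, ← Category.assoc _ g, hg, Category.assoc, hk,
          HomologicalComplex.Hom.comm_assoc])
    refine ⟨s, hts, h ≫ π, ?_⟩
    rw [← Category.assoc, hh, Preadditive.sub_comp, Category.assoc, Category.assoc, hzero,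
      Projective.factorThru_comp, comp_zero, sub_zero]
  · intro H t f hf
    obtain ⟨g, hg⟩ := (isCoboundary_succ_iff _ _).1 (IsCoboundary.of_smul_end_eq_top hE
      (projectiveResolution (powQuotient I t)) (f ≫ ι) (by
        rw [← Category.assoc, hf, zero_comp]))
    obtain ⟨s, hts, h, hh⟩ := H t (g ≫ π) (by
      rw [← Category.assoc, hg, Category.assoc, hzero, comp_zero])
    obtain ⟨k, hk⟩ := exists_comp_eq_of_comp_eq_zero hex hι
      ((powResolutionMap I hts).f n ≫ g -
        (projectiveResolution (powQuotient I s)).complex.d n _ ≫ Projective.factorThru h π) (by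
      rw [Preadditive.sub_comp, Category.assoc, Category.assoc, Projective.factorThru_comp, hh,
        sub_self])
    refine ⟨s, hts, (isCoboundary_succ_iff _ _).2 ⟨k, ?_⟩⟩
    rw [← cancel_mono ι, Category.assoc, hk, Preadditive.comp_sub,
      HomologicalComplex.d_comp_d_assoc, zero_comp, sub_zero,
      ← HomologicalComplex.Hom.comm_assoc, hg, Category.assoc]

lemma isCoboundary_zero_iff {X Y : ModuleCat.{0} R} (P : ProjectiveResolution X)
    (f : P.complex.X 0 ⟶ Y) : IsCoboundary P f ↔ f = 0 := by
  simp [IsCoboundary, eq_comm]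

lemma eq_zero_of_pow_smul {I : Ideal R} {M : Type} [AddCommGroup M] [Module R M]
    (H : ∀ z : M, (∀ a ∈ I, a • z = 0) → z = 0) (t : ℕ) (z : M)
    (hz : ∀ a ∈ I ^ t, a • z = 0) : z = 0 := by
  induction t generalizing z with
  | zero => simpa using hz 1 (by simp)
  | succ k ih =>
    refine H z fun a ha => ih _ fun b hb => ?_
    rw [← mul_smul]
    exact hz _ (by rw [pow_succ]; exact Ideal.mul_mem_mul hb ha)

lemma subsingleton_localCohomology_zero_iff (I : Ideal R) (M : ModuleCat.{0} R) :
    Subsingleton ((localCohomology I 0).obj M) ↔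
      ∀ z : M, (∀ a ∈ I, a • z = 0) → z = 0 := by
  rw [subsingleton_localCohomology_iff]
  constructor
  · intro H z hz
    let v : powQuotient I 1 ⟶ M := ModuleCat.ofHom
      ((I ^ 1).liftQ (LinearMap.toSpanSingleton R M z) fun a ha => by
        rw [LinearMap.mem_ker, LinearMap.toSpanSingleton_apply]
        exact hz a (by rwa [pow_one] at ha))
    let P (s : ℕ) := projectiveResolution (powQuotient I s)
    let π (s : ℕ) : (P s).complex.X 0 ⟶ powQuotient I s := (P s).π.f 0
    have hd : (P 1).complex.d 1 0 ≫ π 1 = 0 := (P 1).complex_d_comp_π_f_zero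
    obtain ⟨s, hs, hb⟩ := H 1 (π 1 ≫ v) (by
      rw [← Category.assoc]
      exact (congrArg (fun q => q ≫ v) hd).trans zero_comp)
    have hlift : (powResolutionMap I hs).f 0 ≫ π 1 = π s ≫ powQuotientMap I hs :=
      ProjectiveResolution.lift_commutes_zero (powQuotientMap I hs) (P s) (P 1)
    have hepi : Epi (π s) := inferInstanceAs (Epi ((P s).π.f 0))
    rw [isCoboundary_zero_iff, ← Category.assoc, hlift, Category.assoc] at hb
    have hv : powQuotientMap I hs ≫ v = 0 := by
      rw [← cancel_epi (π s), hb, comp_zero]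
    have h1 : (1 : R) • z = 0 :=
      congrArg (fun q => q.hom (Ideal.Quotient.mk (I ^ s) 1)) hv
    rwa [one_smul] at h1
  · intro H t f hf
    refine ⟨t, le_rfl, (isCoboundary_zero_iff _ _).2 ?_⟩
    suffices h : f = 0 by rw [h, comp_zero]
    ext x
    refine eq_zero_of_pow_smul H t _ fun a ha => ?_
    have := (isCoboundary_zero_iff _ _).1 (isCoboundary_smul I _ f hf ha)
    exact congrArg (fun q => q.hom x) this

end DimensionShift

section LocalDepth

variable {R : Type} [CommRing R]

lemma smul_end_eq_top_of_one_mem {I : Ideal R} {E : Type} [AddCommGroup E] [Module R E]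
    (h : (1 : Module.End R E) ∈ I • (⊤ : Submodule R (Module.End R E))) :
    I • (⊤ : Submodule R (Module.End R E)) = ⊤ := by
  refine eq_top_iff.2 fun v _ => ?_
  suffices H : ∀ u ∈ I • (⊤ : Submodule R (Module.End R E)),
      u * v ∈ I • (⊤ : Submodule R (Module.End R E)) by
    simpa using H 1 h
  intro u hu
  induction hu using Submodule.smul_induction_on' with
  | smul a ha u _ =>
    rw [smul_mul_assoc]
    exact Submodule.smul_mem_smul ha Submodule.mem_top
  | add u _ w _ hu hw => rw [add_mul]; exact add_mem hu hw

lemma natCast_le_localDepth_iff_s15 [IsLocalRing R] (M : Type) [AddCommGroup M] [Module R M] (n : ℕ) :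
    (n : ℕ∞) ≤ localDepth R M ↔ ∀ i < n, Subsingleton
      ((localCohomology (IsLocalRing.maximalIdeal R) i).obj (ModuleCat.of R M)) := by
  rw [localDepth, le_sInf_iff]
  constructor
  · intro h i hi
    by_contra hs
    have := h i ⟨i, rfl, not_subsingleton_iff_nontrivial.1 hs⟩
    exact absurd hi (not_lt.2 (by exact_mod_cast this))
  · rintro h _ ⟨m, rfl, hm⟩
    by_contra hlt
    exact not_subsingleton_iff_nontrivial.2 hm (h m (by exact_mod_cast not_le.1 hlt))

lemma one_le_localDepth_iff [IsLocalRing R] (M : Type) [AddCommGroup M] [Module R M] :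
    1 ≤ localDepth R M ↔
      ∀ z : M, (∀ a ∈ IsLocalRing.maximalIdeal R, a • z = 0) → z = 0 := by
  rw [← Nat.cast_one, natCast_le_localDepth_iff_s15]
  simp only [Nat.lt_one_iff, forall_eq]
  exact subsingleton_localCohomology_zero_iff _ _

lemma succ_le_localDepth_iff [IsLocalRing R] {M E Q : Type} [AddCommGroup M] [Module R M]
    [AddCommGroup E] [Module R E] [AddCommGroup Q] [Module R Q] {f : M →ₗ[R] E} {g : E →ₗ[R] Q}
    (hf : Function.Injective f) (hfg : Function.Exact f g) (hg : Function.Surjective g)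
    (hE : IsLocalRing.maximalIdeal R • (⊤ : Submodule R (Module.End R E)) = ⊤) (n : ℕ) :
    ((n + 1 : ℕ) : ℕ∞) ≤ localDepth R M ↔ (n : ℕ∞) ≤ localDepth R Q := by
  have hE' : IsLocalRing.maximalIdeal R •
      (⊤ : Submodule R (ModuleCat.of R E ⟶ ModuleCat.of R E)) = ⊤ := by
    have := congrArg (Submodule.map
      (ModuleCat.homLinearEquiv (S := R) (M := ModuleCat.of R E)
        (N := ModuleCat.of R E)).symm.toLinearMap) hE
    rwa [Submodule.map_smul'', Submodule.map_top, LinearEquiv.range] at this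
  have hshift (i : ℕ) := subsingleton_localCohomology_succ_iff (IsLocalRing.maximalIdeal R) i
    (ι := ModuleCat.ofHom f) (π := ModuleCat.ofHom g) hfg hf hg hE'
  rw [natCast_le_localDepth_iff_s15, natCast_le_localDepth_iff_s15]
  constructor
  · exact fun h i hi => (hshift i).1 (h (i + 1) (by omega))
  · intro h i hi
    cases i with
    | zero =>
      refine (subsingleton_localCohomology_zero_iff _ _).2 fun z hz => hf ?_
      rw [map_zero]
      exact eq_zero_of_smul_end_eq_top hE _ fun a ha => by
        rw [← map_smul]; exact (congrArg f (hz a ha)).trans (map_zero f)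
    | succ j => exact (hshift j).2 (h j (by omega))

end LocalDepth

section PrimeLocalDepth

variable {S : Type} [CommRing S]

lemma localizedModule_mk_eq_zero_iff {P : Ideal S} [P.IsPrime] {M : Type} [AddCommGroup M]
    [Module S M] (m : M) (t : P.primeCompl) :
    LocalizedModule.mk m t = 0 ↔ ∃ s ∉ P, s • m = 0 := by
  rw [IsLocalizedModule.mk_eq_mk', IsLocalizedModule.mk'_eq_zero']
  exact ⟨fun ⟨s, hs⟩ => ⟨s, s.2, hs⟩, fun ⟨s, hs, h⟩ => ⟨⟨s, hs⟩, h⟩⟩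

lemma one_le_primeLocalDepth_iff {P : Ideal S} (hP : P.IsPrime) (M : Type)
    [AddCommGroup M] [Module S M] :
    1 ≤ primeLocalDepth S P hP M ↔
      ∀ z : M, (∀ a ∈ P, ∃ s ∉ P, s • a • z = 0) → ∃ s ∉ P, s • z = 0 := by
  refine (one_le_localDepth_iff _).trans ⟨fun H z hz => ?_, fun H x hx => ?_⟩
  · refine (localizedModule_mk_eq_zero_iff z 1).1 (H _ fun a ha => ?_)
    obtain ⟨b, t, rfl⟩ := IsLocalization.exists_mk'_eq P.primeCompl a
    rw [← Localization.mk_eq_mk', LocalizedModule.mk_smul_mk, localizedModule_mk_eq_zero_iff]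
    exact hz b ((IsLocalization.AtPrime.mk'_mem_maximal_iff _ P b t).1 ha)
  · induction x using LocalizedModule.induction_on with
    | h m t =>
      refine (localizedModule_mk_eq_zero_iff m t).2 (H m fun a ha => ?_)
      refine (localizedModule_mk_eq_zero_iff (a • m) t).1 ?_
      have := hx (algebraMap S _ a) ((IsLocalization.AtPrime.to_map_mem_maximal_iff _ P a).2 ha)
      rwa [algebraMap_smul, LocalizedModule.smul'_mk] at this

lemma succ_le_primeLocalDepth_iff {P : Ideal S} (hP : P.IsPrime) {M E Q : Type}
    [AddCommGroup M] [Module S M] [AddCommGroup E] [Module S E] [AddCommGroup Q] [Module S Q]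
    {f : M →ₗ[S] E} {g : E →ₗ[S] Q} (hf : ∀ z, f z = 0 → ∃ s ∉ P, s • z = 0)
    (hfg : Function.Exact f g) (hg : Function.Surjective g)
    (hE : (1 : Module.End S E) ∈ P • (⊤ : Submodule S (Module.End S E))) (n : ℕ) :
    ((n + 1 : ℕ) : ℕ∞) ≤ primeLocalDepth S P hP M ↔ (n : ℕ∞) ≤ primeLocalDepth S P hP Q := by
  refine succ_le_localDepth_iff (f := LocalizedModule.map P.primeCompl f)
    (g := LocalizedModule.map P.primeCompl g) ?_ ?_ ?_ ?_ n
  · refine (injective_iff_map_eq_zero _).2 fun x hx => ?_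
    induction x using LocalizedModule.induction_on with
    | h m s =>
      rw [LocalizedModule.map_mk, localizedModule_mk_eq_zero_iff] at hx
      obtain ⟨c, hc, h⟩ := hx
      obtain ⟨s', hs', h'⟩ := hf (c • m) (by rw [map_smul, h])
      refine (localizedModule_mk_eq_zero_iff m s).2 ⟨s' * c, hP.mul_notMem hs' hc, ?_⟩
      rw [mul_smul, h']
  · exact LocalizedModule.map_exact P.primeCompl f g hfg
  · exact LocalizedModule.map_surjective P.primeCompl g hg
  · apply smul_end_eq_top_of_one_mem
    suffices H : ∀ u ∈ P • (⊤ : Submodule S (Module.End S E)),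
        LocalizedModule.map P.primeCompl u ∈ IsLocalRing.maximalIdeal (Localization.AtPrime P) •
          (⊤ : Submodule (Localization.AtPrime P)
            (Module.End (Localization.AtPrime P) (LocalizedModule P.primeCompl E))) by
      have h1 : LocalizedModule.map P.primeCompl (1 : Module.End S E) = 1 :=
        LocalizedModule.map_id P.primeCompl
      exact h1 ▸ H 1 hE
    intro u hu
    induction hu using Submodule.smul_induction_on' with
    | smul a ha u _ =>
      rw [map_smul, ← algebraMap_smul (Localization.AtPrime P) a (LocalizedModule.map _ u)]
      exact Submodule.smul_mem_smul
        ((IsLocalization.AtPrime.to_map_mem_maximal_iff _ P a).2 ha) Submodule.mem_top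
    | add u _ w _ hu hw => rw [map_add]; exact add_mem hu hw

end PrimeLocalDepth

section LocalTorsion

variable {S : Type} [CommRing S]

/-- The annihilator of the image of `z` in the localization of `M` at the prime `P`. -/
noncomputable def localAnnihilator (P : Ideal S) [P.IsPrime] {M : Type} [AddCommGroup M]
    [Module S M] (z : M) : Ideal S :=
  LinearMap.ker (LocalizedModule.mkLinearMap P.primeCompl M ∘ₗ LinearMap.toSpanSingleton S M z)

lemma mem_localAnnihilator {P : Ideal S} [P.IsPrime] {M : Type} [AddCommGroup M] [Module S M]
    {z : M} {b : S} :
    b ∈ localAnnihilator P z ↔ ∃ s ∉ P, s • b • z = 0 :=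
  localizedModule_mk_eq_zero_iff (b • z) 1

lemma one_le_primeLocalDepth_iff_localAnnihilator {P : Ideal S}
    (hP : P.IsPrime) (M : Type) [AddCommGroup M] [Module S M] :
    1 ≤ primeLocalDepth S P hP M ↔
      ∀ z : M, P ≤ localAnnihilator P z → ∃ s ∉ P, s • z = 0 := by
  refine (one_le_primeLocalDepth_iff hP M).trans (forall_congr' fun z => imp_congr_left ?_)
  exact forall₂_congr fun a _ => mem_localAnnihilator.symm

variable {P : Ideal S} [P.IsPrime] {M : Type} [AddCommGroup M] [Module S M]

lemma exists_smul_eq_zero_of_pow_le_localAnnihilator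
    (H : ∀ z : M, P ≤ localAnnihilator P z → ∃ s ∉ P, s • z = 0) (K : ℕ) (z : M)
    (hz : P ^ K ≤ localAnnihilator P z) : ∃ s ∉ P, s • z = 0 := by
  induction K generalizing z with
  | zero => simpa using mem_localAnnihilator.1 (hz (by simp : (1 : S) ∈ P ^ 0))
  | succ K ih =>
    refine H z fun a ha => mem_localAnnihilator.2 (ih _ fun b hb => mem_localAnnihilator.2 ?_)
    rw [← mul_smul b]
    exact mem_localAnnihilator.1 (hz (by rw [pow_succ]; exact Ideal.mul_mem_mul hb ha))

lemma exists_mul_pow_mem {J : Ideal S}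
    (hJ : ∀ Q : Ideal S, Q.IsPrime → J ≤ Q → Q ≤ P → Q = P) {a : S} (ha : a ∈ P) :
    ∃ s ∉ P, ∃ k : ℕ, s * a ^ k ∈ J := by
  by_contra! h
  obtain ⟨Q, hQ, hJQ, hdisj⟩ := Ideal.exists_le_prime_disjoint J
    (P.primeCompl ⊔ Submonoid.powers a) (by
      refine Set.disjoint_left.2 fun b hb hb' => ?_
      obtain ⟨s, hs, _, ⟨k, rfl⟩, rfl⟩ := Submonoid.mem_sup.1 hb'
      exact h s hs k hb)
  have hQP : Q ≤ P := fun b hb => by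
    by_contra hbP
    exact Set.disjoint_left.1 hdisj hb (Submonoid.mem_sup_left hbP)
  have hEq := hJ Q hQ hJQ hQP
  exact Set.disjoint_left.1 hdisj (hEq ▸ ha)
    (Submonoid.mem_sup_right (Submonoid.mem_powers a))

lemma exists_smul_eq_zero_of_le_radical (hP : P.FG)
    (H : ∀ z : M, P ≤ localAnnihilator P z → ∃ s ∉ P, s • z = 0) {J : Ideal S}
    (hJ : ∀ Q : Ideal S, Q.IsPrime → J ≤ Q → Q ≤ P → Q = P) {z : M}
    (hz : J ≤ (localAnnihilator P z).radical) : ∃ s ∉ P, s • z = 0 := by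
  have hrad : P ≤ (localAnnihilator P z).radical := fun a ha => by
    obtain ⟨s, hs, k, hk⟩ := exists_mul_pow_mem hJ ha
    obtain ⟨m, hm⟩ := hz hk
    obtain ⟨c, hc, h⟩ := mem_localAnnihilator.1 hm
    refine ⟨k * m, mem_localAnnihilator.2 ⟨c * s ^ m, ?_, ?_⟩⟩
    · exact Ideal.IsPrime.mul_notMem inferInstance hc
        fun h => hs (Ideal.IsPrime.mem_of_pow_mem inferInstance _ h)
    · rw [← h, mul_pow, ← pow_mul, mul_smul, ← mul_smul (s ^ m)]
  obtain ⟨K, hK⟩ := Ideal.exists_pow_le_of_le_radical_of_fg hrad hP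
  exact exists_smul_eq_zero_of_pow_le_localAnnihilator H K z hK

lemma exists_forall_smul_eq_zero {J : Ideal S} (hJ : J.FG) {z : M}
    (hz : J ≤ localAnnihilator P z) : ∃ s ∉ P, ∀ a ∈ J, a • s • z = 0 := by
  revert hz
  refine Submodule.fg_induction
    (motive := fun J _ => J ≤ localAnnihilator P z → ∃ s ∉ P, ∀ a ∈ J, a • s • z = 0) ?_ ?_ J hJ
  · intro x hx
    obtain ⟨s, hs, h⟩ := mem_localAnnihilator.1 (hx (Submodule.mem_span_singleton_self x))
    refine ⟨s, hs, fun a ha => ?_⟩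
    obtain ⟨c, rfl⟩ := Submodule.mem_span_singleton.1 ha
    rw [smul_assoc, smul_comm x, h, smul_zero]
  · intro J₁ J₂ _ _ h₁ h₂ hle
    obtain ⟨s₁, hs₁, h₁⟩ := h₁ (le_sup_left.trans hle)
    obtain ⟨s₂, hs₂, h₂⟩ := h₂ (le_sup_right.trans hle)
    refine ⟨s₁ * s₂, Ideal.IsPrime.mul_notMem inferInstance hs₁ hs₂, fun a ha => ?_⟩
    obtain ⟨b, hb, c, hc, rfl⟩ := Submodule.mem_sup.1 ha
    rw [add_smul, mul_smul, smul_comm c, h₂ c hc, smul_zero, add_zero, smul_comm s₁, smul_comm b,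
      h₁ b hb, smul_zero]

/-- A module embeds, up to `x`-power torsion, into one on which the `x j` generate the
unit endomorphism. -/
lemma exists_exact_sum_smul_eq_one {ι : Type} [Fintype ι] (x : ι → S) (M : Type)
    [AddCommGroup M] [Module S M] :
    ∃ (E Q : Type) (_ : AddCommGroup E) (_ : AddCommGroup Q) (_ : Module S E) (_ : Module S Q)
      (f : M →ₗ[S] E) (g : E →ₗ[S] Q) (u : ι → Module.End S E),
      Function.Exact f g ∧ Function.Surjective g ∧
      (∀ z, f z = 0 → ∀ j, ∃ k : ℕ, x j ^ k • z = 0) ∧ ∑ j, x j • u j = 1 := by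
  classical
  let F (j : ι) := LocalizedModule (Submonoid.powers (x j)) M
  let ℓ (j : ι) : M →ₗ[S] F j := LocalizedModule.mkLinearMap (Submonoid.powers (x j)) M
  let f : M →ₗ[S] (∀ j, F j) := LinearMap.pi ℓ
  have hunit (j : ι) : IsUnit (algebraMap S (Module.End S (F j)) (x j)) :=
    IsLocalizedModule.map_units (ℓ j) ⟨x j, Submonoid.mem_powers _⟩
  choose v hv using hunit
  refine ⟨∀ j, F j, (∀ j, F j) ⧸ LinearMap.range f, inferInstance, inferInstance, inferInstance,
    inferInstance, f, (LinearMap.range f).mkQ,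
    fun j => LinearMap.single S F j ∘ₗ (↑(v j)⁻¹ : Module.End S (F j)) ∘ₗ LinearMap.proj j,
    LinearMap.exact_map_mkQ_range f, Submodule.mkQ_surjective _, fun z hz j => ?_, ?_⟩
  · obtain ⟨⟨_, k, rfl⟩, h⟩ := (IsLocalizedModule.eq_zero_iff (Submonoid.powers (x j)) (ℓ j)).1
      (congrFun hz j)
    exact ⟨k, h⟩
  · have h (j : ι) : x j • (LinearMap.single S F j ∘ₗ (↑(v j)⁻¹ : Module.End S (F j)) ∘ₗ
        LinearMap.proj j) = LinearMap.single S F j ∘ₗ LinearMap.proj j := by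
      have h1 : x j • (↑(v j)⁻¹ : Module.End S (F j)) = 1 := by
        rw [Algebra.smul_def, ← hv, Units.mul_inv]
      rw [← LinearMap.comp_smul, ← LinearMap.smul_comp, h1]
      rfl
    simp_rw [h]
    ext z j
    simp

end LocalTorsion

section ZeroDimensionalFibers

variable {A B : Type} [CommRing A] [CommRing B] [IsNoetherianRing A] [IsNoetherianRing B]
  [Algebra A B]

lemma one_le_primeLocalDepth_iff_forall
    (hfib : ∀ P Q : Ideal B, P.IsPrime → Q.IsPrime → P ≤ Q →
      P.comap (algebraMap A B) = Q.comap (algebraMap A B) → P = Q)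
    {p : Ideal A} (hp : p.IsPrime) (M : Type) [AddCommGroup M] [Module B M] [Module A M]
    [IsScalarTower A B M] :
    1 ≤ primeLocalDepth A p hp M ↔ ∀ (P : Ideal B) (hP : P.IsPrime),
      P.comap (algebraMap A B) = p → 1 ≤ primeLocalDepth B P hP M := by
  simp_rw [one_le_primeLocalDepth_iff_localAnnihilator]
  constructor
  · rintro H P hP rfl z hz
    obtain ⟨s, hs, h⟩ := exists_forall_smul_eq_zero (IsNoetherian.noetherian P) hz
    obtain ⟨t, ht, ht'⟩ := H (s • z) fun a ha =>
      mem_localAnnihilator.2 ⟨1, hp.one_notMem, by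
        rw [one_smul, ← algebraMap_smul B a (s • z), h _ ha]⟩
    exact ⟨algebraMap A B t * s, hP.mul_notMem ht hs, by rwa [mul_smul, algebraMap_smul]⟩
  · intro H z hz
    obtain ⟨s, hs, h⟩ := exists_forall_smul_eq_zero (IsNoetherian.noetherian p) hz
    suffices hw : ∃ t ∉ p, t • s • z = 0 by
      obtain ⟨t, ht, hw⟩ := hw
      exact ⟨t * s, hp.mul_notMem ht hs, by rw [mul_smul, hw]⟩
    by_contra! hw
    obtain ⟨P, hP, hle, hdisj⟩ := Ideal.exists_le_prime_disjoint
      (LinearMap.ker (LinearMap.toSpanSingleton B M (s • z)))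
      (p.primeCompl.map (algebraMap A B)) (by
        refine Set.disjoint_left.2 ?_
        rintro _ hb ⟨t, ht, rfl⟩
        refine hw t ht ?_
        simpa [algebraMap_smul] using hb)
    have hpP : P.comap (algebraMap A B) = p := by
      refine le_antisymm (fun a ha => ?_) fun a ha => hle ?_
      · by_contra hap
        exact Set.disjoint_left.1 hdisj ha ⟨a, hap, rfl⟩
      · simpa [algebraMap_smul] using h a ha
    obtain ⟨t, ht, ht'⟩ := exists_smul_eq_zero_of_le_radical (IsNoetherian.noetherian P)
      (H P hP hpP) (J := p.map (algebraMap A B)) (z := s • z) (fun Q hQ hJQ hQP =>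
        hfib Q P hQ hP hQP (le_antisymm (Ideal.comap_mono hQP)
          (hpP.trans_le (Ideal.map_le_iff_le_comap.1 hJQ))))
      (Ideal.map_le_iff_le_comap.2 fun a ha => Ideal.le_radical (mem_localAnnihilator.2
        ⟨1, hP.one_notMem, by rw [one_smul, algebraMap_smul, h a ha]⟩))
    exact ht (hle (by simpa using ht'))

lemma natCast_le_primeLocalDepth_iff_forall
    (hfib : ∀ P Q : Ideal B, P.IsPrime → Q.IsPrime → P ≤ Q →
      P.comap (algebraMap A B) = Q.comap (algebraMap A B) → P = Q)
    {p : Ideal A} (hp : p.IsPrime) (n : ℕ) (M : Type) [AddCommGroup M] [Module B M] [Module A M]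
    [IsScalarTower A B M] :
    (n : ℕ∞) ≤ primeLocalDepth A p hp M ↔ ∀ (P : Ideal B) (hP : P.IsPrime),
      P.comap (algebraMap A B) = p → (n : ℕ∞) ≤ primeLocalDepth B P hP M := by
  induction n generalizing M with
  | zero => simp
  | succ n ih =>
    have hone : (1 : ℕ∞) ≤ ((n + 1 : ℕ) : ℕ∞) := by exact_mod_cast Nat.le_add_left 1 n
    have hiff := one_le_primeLocalDepth_iff_forall hfib hp M
    by_cases hA : 1 ≤ primeLocalDepth A p hp M
    swap
    · exact iff_of_false (fun h => hA (hone.trans h))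
        fun h => hA (hiff.2 fun P hP hpP => hone.trans (h P hP hpP))
    have hB := hiff.1 hA
    simp_rw [one_le_primeLocalDepth_iff_localAnnihilator] at hA hB
    obtain ⟨m, x, hx⟩ := Submodule.fg_iff_exists_fin_generating_family.1
      (IsNoetherian.noetherian p)
    have hxp (j : Fin m) : x j ∈ p := hx ▸ Submodule.subset_span ⟨j, rfl⟩
    obtain ⟨E, Q, _, _, _, _, f, g, u, hfg, hg, htors, hu⟩ :=
      exists_exact_sum_smul_eq_one (fun j => algebraMap A B (x j)) M
    let _ : Module A E := Module.compHom E (algebraMap A B)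
    let _ : Module A Q := Module.compHom Q (algebraMap A B)
    have _ : IsScalarTower A B E := ⟨fun a b e => by
      rw [Algebra.smul_def, mul_smul]; rfl⟩
    have _ : IsScalarTower A B Q := ⟨fun a b e => by
      rw [Algebra.smul_def, mul_smul]; rfl⟩
    have hAQ : ((n + 1 : ℕ) : ℕ∞) ≤ primeLocalDepth A p hp M ↔
        (n : ℕ∞) ≤ primeLocalDepth A p hp Q := by
      refine succ_le_primeLocalDepth_iff hp (f := f.restrictScalars A) (g := g.restrictScalars A)
        (fun z hz => ?_) hfg hg ?_ n
      · refine exists_smul_eq_zero_of_le_radical (IsNoetherian.noetherian p) hA (J := p)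
          (fun Q _ h h' => le_antisymm h' h) ?_
        conv_lhs => rw [← hx]
        refine Submodule.span_le.2 ?_
        rintro _ ⟨j, rfl⟩
        obtain ⟨k, hk⟩ := htors z hz j
        refine ⟨k, mem_localAnnihilator.2 ⟨1, hp.one_notMem, ?_⟩⟩
        rw [one_smul, ← algebraMap_smul B, map_pow, hk]
      · have h1 : (1 : Module.End A E) = ∑ j, x j • (u j).restrictScalars A := by
          ext z
          have := congrArg (fun q => q z) hu
          simpa [algebraMap_smul] using this.symm
        rw [h1]
        exact Submodule.sum_mem _ fun j _ => Submodule.smul_mem_smul (hxp j) Submodule.mem_top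
    refine hAQ.trans ((ih Q).trans (forall₂_congr fun P hP => forall_congr' fun hpP => ?_))
    refine (succ_le_primeLocalDepth_iff hP (fun z hz => ?_) hfg hg ?_ n).symm
    · refine exists_smul_eq_zero_of_le_radical (IsNoetherian.noetherian P) (hB P hP hpP)
        (J := p.map (algebraMap A B)) (fun Q hQ hJQ hQP =>
          hfib Q P hQ hP hQP (le_antisymm (Ideal.comap_mono hQP)
            (hpP.trans_le (Ideal.map_le_iff_le_comap.1 hJQ)))) ?_
      rw [Ideal.map_le_iff_le_comap]
      conv_lhs => rw [← hx]
      refine Submodule.span_le.2 ?_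
      rintro _ ⟨j, rfl⟩
      obtain ⟨k, hk⟩ := htors z hz j
      exact ⟨k, mem_localAnnihilator.2 ⟨1, hP.one_notMem, by rw [one_smul, hk]⟩⟩
    · rw [← hu]
      refine Submodule.sum_mem _ fun j _ => Submodule.smul_mem_smul ?_ Submodule.mem_top
      exact hpP.ge (hxp j)

lemma primeKrullDim_le_of_going_down
    (hgd : ∀ (P : Ideal B) (_ : P.IsPrime) (q : Ideal A) (_ : q.IsPrime),
      q ≤ P.comap (algebraMap A B) →
        ∃ (Q : Ideal B) (_ : Q.IsPrime), Q ≤ P ∧ Q.comap (algebraMap A B) = q)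
    {p : Ideal A} (hp : p.IsPrime) {P : Ideal B} (hP : P.IsPrime)
    (hpP : P.comap (algebraMap A B) = p) : primeKrullDim A p hp ≤ primeKrullDim B P hP := by
  have : Algebra.HasGoingDown A B := ⟨fun {q} hq P hP h => by
    obtain ⟨Q, hQ, hQP, hQq⟩ := hgd P hP q hq h.le
    exact ⟨Q, hQP, hQ, ⟨hQq.symm⟩⟩⟩
  have : P.LiesOver p := ⟨hpP.symm⟩
  rw [primeKrullDim, primeKrullDim, IsLocalization.AtPrime.ringKrullDim_eq_height p,
    IsLocalization.AtPrime.ringKrullDim_eq_height P,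
    Ideal.height_eq_height_add_of_liesOver_of_hasGoingDown p P]
  exact_mod_cast le_self_add

end ZeroDimensionalFibers

/-- **Depth along zero-dimensional fibers.**
Let `A → B` be a homomorphism of Noetherian rings whose fibers are
zero-dimensional (no two distinct comparable primes of `B` lie over the same
prime of `A`), and let `M` be a (possibly infinite) `B`-module.  Then for every
prime `p` of `A`,
`depth_{A_p} M_p = inf { depth_{B_P} M_P : P a prime of B lying over p }`.
If moreover the going-down theorem holds between `A` and `B` and `M` satisfies
`(S'_n)` as a `B`-module, then `M` satisfies `(S'_n)` as an `A`-module. -/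
theorem depth_eq_inf_of_zero_dimensional_fibers
    (A B : Type) [CommRing A] [CommRing B] [IsNoetherianRing A] [IsNoetherianRing B]
    [Algebra A B]
    (hfib : ∀ (P Q : Ideal B), P.IsPrime → Q.IsPrime → P ≤ Q →
      P.comap (algebraMap A B) = Q.comap (algebraMap A B) → P = Q)
    (M : Type) [AddCommGroup M] [Module B M] [Module A M] [IsScalarTower A B M] :
    (∀ (p : Ideal A) (hp : p.IsPrime),
      primeLocalDepth A p hp M =
        sInf {d : ℕ∞ | ∃ (P : Ideal B) (hP : P.IsPrime),
          P.comap (algebraMap A B) = p ∧ d = primeLocalDepth B P hP M}) ∧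
    ((∀ (P : Ideal B) (_ : P.IsPrime) (q : Ideal A) (_ : q.IsPrime),
        q ≤ P.comap (algebraMap A B) →
        ∃ (Q : Ideal B) (_ : Q.IsPrime), Q ≤ P ∧ Q.comap (algebraMap A B) = q) →
      ∀ n : ℕ, SerreS' B M n → SerreS' A M n) := by
  have hdepth (p : Ideal A) (hp : p.IsPrime) : primeLocalDepth A p hp M =
      sInf {d : ℕ∞ | ∃ (P : Ideal B) (hP : P.IsPrime),
        P.comap (algebraMap A B) = p ∧ d = primeLocalDepth B P hP M} := by
    refine ENat.eq_of_forall_natCast_le_iff fun n => ?_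
    rw [natCast_le_primeLocalDepth_iff_forall hfib hp n M, le_sInf_iff]
    exact ⟨fun h d ⟨P, hP, hpP, hd⟩ => hd ▸ h P hP hpP, fun h P hP hpP => h _ ⟨P, hP, hpP, rfl⟩⟩
  refine ⟨hdepth, fun hgd n hM p hp => ?_⟩
  obtain ⟨c, hc⟩ : ∃ c : ℕ∞, (c : WithBot ℕ∞) = min (n : WithBot ℕ∞) (primeKrullDim A p hp) :=
    ⟨min n p.height, by
      rw [primeKrullDim, IsLocalization.AtPrime.ringKrullDim_eq_height p]; rfl⟩
  rw [← hc, WithBot.coe_le_coe, hdepth p hp, le_sInf_iff]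
  rintro _ ⟨P, hP, hpP, rfl⟩
  rw [← WithBot.coe_le_coe, hc]
  exact (min_le_min_left _ (primeKrullDim_le_of_going_down hgd hp hP hpP)).trans (hM P hP)
end
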